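/- arXiv:math/0510575 — 2 statements merged into one kernel-verified Lean document; each statement's English description precedes it below -/
import Mathlib

section
/- Fix reals a < b, and let G : ℕ → (0,∞) be a decreasing sequence with G(0) = 1 and lim_{n→∞} G(n) = 0; set ΔG(n) := G(n) − G(n+1). Then for every s ≥ 0 and every Γ ∈ F_s, lim_{t→∞} E_0[ 1_Γ · ΔG(D_t) ] / E_0[ ΔG(D_t) ] = E_0[ 1_Γ · M_s^{↓,G} ] / M_0^{↓,G}. -/
open MeasureTheory ProbabilityTheory Filter
open scoped NNReal ENNReal Topology

noncomputable section

/-- The natural filtration `F_t = σ(X_s : s ≤ t)` of a real-valued process indexed by `ℝ≥0`. -/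
def natFiltration {Ω : Type*} [m : MeasurableSpace Ω] (X : ℝ≥0 → Ω → ℝ) :
    MeasureTheory.Filtration ℝ≥0 m where
  seq t := (⨆ s ∈ Set.Iic t, MeasurableSpace.comap (X s) Real.measurableSpace) ⊓ m
  mono' := fun s t hst =>
    inf_le_inf_right m (biSup_mono fun u (hu : u ∈ Set.Iic s) => le_trans hu hst)
  le' := fun _ => inf_le_right

/-- The running supremum `S_t = sup_{0 ≤ u ≤ t} X_u` of a process indexed by `ℝ≥0`. -/
def runSup {Ω : Type*} (X : ℝ≥0 → Ω → ℝ) (t : ℝ≥0) (ω : Ω) : ℝ :=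
  sSup ((fun u => X u ω) '' Set.Iic t)

/-- A real-valued process `X` indexed by `ℝ≥0` is a standard one-dimensional Brownian
motion started at `x` under `P`. -/
structure IsBrownianMotion {Ω : Type*} [m : MeasurableSpace Ω] (P : Measure Ω)
    (X : ℝ≥0 → Ω → ℝ) (x : ℝ) : Prop where
  stronglyMeasurable : ∀ t, StronglyMeasurable (X t)
  init : ∀ᵐ ω ∂P, X 0 ω = x
  cont : ∀ᵐ ω ∂P, Continuous fun t => X t ω
  gauss_incr : ∀ s t : ℝ≥0, s ≤ t →
    P.map (fun ω => X t ω - X s ω) = gaussianReal 0 (t - s)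
  indep_incr : ∀ s t : ℝ≥0, s ≤ t →
    Indep (MeasurableSpace.comap (fun ω => X t ω - X s ω) Real.measurableSpace)
      (natFiltration X s) P

open scoped Classical in
/-- The alternating sequence of stopping times of up-crossings of `b` and
down-crossings of `a`: `σ_0 = 0`, `σ_{2n+1} = inf{t ≥ σ_{2n} : X_t > b}`,
`σ_{2n+2} = inf{t ≥ σ_{2n+1} : X_t < a}` (with `inf ∅ = ∞`). -/
noncomputable def dcSigma {Ω : Type*} (a b : ℝ) (X : ℝ≥0 → Ω → ℝ) (ω : Ω) : ℕ → ℝ≥0∞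
  | 0 => 0
  | Nat.succ n =>
      sInf ((fun u : ℝ≥0 => (u : ℝ≥0∞)) ''
        {u : ℝ≥0 | dcSigma a b X ω n ≤ (u : ℝ≥0∞) ∧
          (if Even n then b < X u ω else X u ω < a)})

/-- `D_t`, the number of down-crossings from `b` to `a` before time `t`:
the number of indices `n ≥ 1` with `σ_{2n} ≤ t`. -/
noncomputable def dcD {Ω : Type*} (a b : ℝ) (X : ℝ≥0 → Ω → ℝ) (t : ℝ≥0) (ω : Ω) : ℕ :=
  Set.ncard {n : ℕ | 1 ≤ n ∧ dcSigma a b X ω (2 * n) ≤ (t : ℝ≥0∞)}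

open scoped Classical in
/-- The down-crossing martingale `M_t^{↓,G}`. -/
noncomputable def dcM {Ω : Type*} (a b : ℝ) (G : ℕ → ℝ) (X : ℝ≥0 → Ω → ℝ)
    (t : ℝ≥0) (ω : Ω) : ℝ :=
  ∑' n : ℕ,
    ((if dcSigma a b X ω (2 * n) ≤ (t : ℝ≥0∞) ∧ (t : ℝ≥0∞) < dcSigma a b X ω (2 * n + 1)
        then G n / 2 * (1 + (b - X t ω) / (b - a)) + G (n + 1) / 2 * ((X t ω - a) / (b - a))
        else 0)
      + (if dcSigma a b X ω (2 * n + 1) ≤ (t : ℝ≥0∞) ∧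
            (t : ℝ≥0∞) < dcSigma a b X ω (2 * n + 2)
        then G (n + 1) / 2 * (1 + (b - X t ω) / (b - a)) + G n / 2 * ((X t ω - a) / (b - a))
        else 0))

/-- The clamp of `n * x` to `[-1, 1]`, an odd Lipschitz approximation of the sign of `x`. -/
def clampMul (n : ℕ) (x : ℝ) : ℝ := max (-1) (min 1 (n * x))

lemma clampMul_neg (n : ℕ) (x : ℝ) : clampMul n (-x) = -clampMul n x := by
  simp only [clampMul, max_def, min_def, mul_neg]
  split_ifs <;> linarith

lemma abs_clampMul_le (n : ℕ) (x : ℝ) : |clampMul n x| ≤ 1 := by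
  unfold clampMul
  rw [abs_le]
  exact ⟨le_max_left _ _, max_le (by norm_num) (min_le_left _ _)⟩

lemma abs_clampMul_sub_le (n : ℕ) (x y : ℝ) : |clampMul n x - clampMul n y| ≤ n * |x - y| := by
  unfold clampMul
  calc _ ≤ |min 1 (n * x) - min 1 (n * y)| := by
        simpa [max_comm] using abs_max_sub_max_le_abs (min 1 (n * x)) (min 1 (n * y)) (-1 : ℝ)
    _ ≤ |n * x - n * y| := by
        simpa using abs_min_sub_min_le_max 1 (n * x) 1 (n * y)
    _ = n * |x - y| := by rw [← mul_sub, abs_mul, Nat.abs_cast]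

lemma continuous_clampMul (n : ℕ) : Continuous (clampMul n) := by
  unfold clampMul
  fun_prop

lemma tendsto_clampMul (x : ℝ) :
    Tendsto (fun n => clampMul n x) atTop (𝓝 (SignType.sign x : ℝ)) := by
  have hpos : ∀ y : ℝ, 0 < y → Tendsto (fun n => clampMul n y) atTop (𝓝 1) := fun y hy => by
    have h : Tendsto (fun n : ℕ => (n : ℝ) * y) atTop atTop :=
      tendsto_natCast_atTop_atTop.atTop_mul_const hy
    refine tendsto_const_nhds.congr' ?_
    filter_upwards [h.eventually_ge_atTop 1] with n hn
    simp [clampMul, hn]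
  rcases lt_trichotomy x 0 with hx | rfl | hx
  · simpa [sign_neg hx, clampMul_neg] using (hpos (-x) (by linarith)).neg
  · simp [clampMul]
  · simpa [sign_pos hx] using hpos x hx

/-- The Gaussian average of `clampMul n` with variance `v`. -/
def heatClamp (n : ℕ) (v : ℝ≥0) (x : ℝ) : ℝ := ∫ z, clampMul n (x + z) ∂gaussianReal 0 v

lemma integrable_clampMul_comp (n : ℕ) {α : Type*} [MeasurableSpace α] (μ : Measure α)
    [IsFiniteMeasure μ] {f : α → ℝ}
    (hf : AEMeasurable f μ) :
    Integrable (fun x => clampMul n (f x)) μ :=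
  Integrable.of_bound ((continuous_clampMul n).measurable.comp_aemeasurable hf).aestronglyMeasurable
    1 (ae_of_all _ fun _ => abs_clampMul_le n _)

lemma abs_heatClamp_le (n : ℕ) (v : ℝ≥0) (x : ℝ) : |heatClamp n v x| ≤ 1 := by
  rw [← Real.norm_eq_abs]
  refine (norm_integral_le_of_norm_le_const (C := 1)
    (ae_of_all _ fun z => abs_clampMul_le n _)).trans ?_
  simp

lemma abs_heatClamp_sub_le (n : ℕ) (v : ℝ≥0) (x y : ℝ) :
    |heatClamp n v x - heatClamp n v y| ≤ n * |x - y| := by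
  unfold heatClamp
  rw [← Real.norm_eq_abs, ← integral_sub
    (integrable_clampMul_comp n (gaussianReal 0 v) (by fun_prop))
    (integrable_clampMul_comp n (gaussianReal 0 v) (by fun_prop))]
  refine (norm_integral_le_of_norm_le_const (C := n * |x - y|) (ae_of_all _ fun z => ?_)).trans ?_
  · simpa using abs_clampMul_sub_le n (x + z) (y + z)
  · simp

lemma continuous_heatClamp (n : ℕ) (v : ℝ≥0) : Continuous (heatClamp n v) := by
  refine LipschitzWith.continuous (K := n) (LipschitzWith.of_dist_le_mul fun x y => ?_)
  simpa [Real.dist_eq] using abs_heatClamp_sub_le n v x y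

lemma integral_comp_neg_gaussianReal (v : ℝ≥0) (f : ℝ → ℝ) :
    ∫ z, f (-z) ∂gaussianReal 0 v = ∫ z, f z ∂gaussianReal 0 v := by
  conv_rhs => rw [← neg_zero, ← gaussianReal_map_neg]
  exact ((MeasurableEquiv.neg ℝ).measurableEmbedding.integral_map f).symm

lemma heatClamp_neg (n : ℕ) (v : ℝ≥0) (x : ℝ) : heatClamp n v (-x) = -heatClamp n v x := by
  unfold heatClamp
  rw [← integral_comp_neg_gaussianReal, ← integral_neg]
  simp_rw [← neg_add, clampMul_neg]

lemma heatClamp_zero_right (n : ℕ) (v : ℝ≥0) : heatClamp n v 0 = 0 := by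
  have := heatClamp_neg n v 0
  rw [neg_zero] at this
  linarith

lemma heatClamp_zero_left (n : ℕ) (x : ℝ) : heatClamp n 0 x = clampMul n x := by
  simp [heatClamp]

lemma integral_heatClamp_add (n : ℕ) (v w : ℝ≥0) (x : ℝ) :
    ∫ z, heatClamp n v (x + z) ∂gaussianReal 0 w = heatClamp n (w + v) x := by
  unfold heatClamp
  have h := gaussianReal_conv_gaussianReal (m₁ := 0) (m₂ := 0) (v₁ := w) (v₂ := v)
  rw [add_zero] at h
  have hm : Continuous fun z => clampMul n (x + z) := (continuous_clampMul n).comp (by fun_prop)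
  rw [← h, Measure.conv, integral_map (by fun_prop) hm.aestronglyMeasurable,
    integral_prod _ (integrable_clampMul_comp n _ (by fun_prop))]
  simp_rw [add_assoc]

lemma integral_heatClamp_sub (n : ℕ) (v w : ℝ≥0) (x : ℝ) :
    ∫ z, heatClamp n v (x - z) ∂gaussianReal 0 w = heatClamp n (w + v) x := by
  rw [← integral_heatClamp_add, ← integral_comp_neg_gaussianReal]
  simp_rw [sub_neg_eq_add]

/-- The probability that a centred Gaussian variable of variance `v` lies in `[-x, x]`. -/
def gaussMass (v : ℝ≥0) (x : ℝ) : ℝ := ∫ z in (-x)..x, gaussianPDFReal 0 v z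

lemma integral_sign_add_gaussianReal {v : ℝ≥0} (hv : v ≠ 0) (x : ℝ) :
    ∫ z, (SignType.sign (x + z) : ℝ) ∂gaussianReal 0 v = gaussMass v x := by
  have hint := integrable_gaussianPDFReal 0 v
  have hsign : ∀ z : ℝ, gaussianPDFReal 0 v z • (SignType.sign (x + z) : ℝ) =
      (Set.Ioi (-x)).indicator (gaussianPDFReal 0 v) z
        - (Set.Iio (-x)).indicator (gaussianPDFReal 0 v) z := fun z => by
    rcases lt_trichotomy z (-x) with h | h | h
    · simp [h, h.le, sign_neg (show x + z < 0 by linarith)]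
    · simp [h]
    · simp [h, h.le, sign_pos (show 0 < x + z by linarith)]
  have hneg : ∫ z in Set.Ioi (-x), gaussianPDFReal 0 v z =
      ∫ z in Set.Iic x, gaussianPDFReal 0 v z := by
    rw [← integral_comp_neg_Iic]
    simp [gaussianPDFReal]
  rw [integral_gaussianReal_eq_integral_smul hv]
  simp_rw [hsign]
  rw [integral_sub (hint.indicator measurableSet_Ioi) (hint.indicator measurableSet_Iio),
    integral_indicator measurableSet_Ioi, integral_indicator measurableSet_Iio, hneg,
    ← integral_Iic_eq_integral_Iio,
    intervalIntegral.integral_Iic_sub_Iic hint.integrableOn hint.integrableOn, gaussMass]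

lemma tendsto_heatClamp {v : ℝ≥0} (hv : v ≠ 0) (x : ℝ) :
    Tendsto (fun n => heatClamp n v x) atTop (𝓝 (gaussMass v x)) := by
  rw [← integral_sign_add_gaussianReal hv]
  refine tendsto_integral_of_dominated_convergence (fun _ => 1) (fun n => ?_) (integrable_const _)
    (fun n => ae_of_all _ fun z => abs_clampMul_le n _) (ae_of_all _ fun z => tendsto_clampMul _)
  exact (integrable_clampMul_comp _ _ (by fun_prop)).aestronglyMeasurable

lemma sqrt_mul_gaussianPDFReal {v : ℝ≥0} (hv : v ≠ 0) (z : ℝ) :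
    √v * gaussianPDFReal 0 v z = (√(2 * Real.pi))⁻¹ * Real.exp (-z ^ 2 / (2 * v)) := by
  have : √(v : ℝ) ≠ 0 := by positivity
  unfold gaussianPDFReal
  rw [Real.sqrt_mul (by positivity), sub_zero]
  field_simp

lemma abs_sqrt_mul_gaussianPDFReal_le (v : ℝ≥0) (z : ℝ) :
    |√v * gaussianPDFReal 0 v z| ≤ (√(2 * Real.pi))⁻¹ := by
  rcases eq_or_ne v 0 with rfl | hv
  · simp
  · rw [sqrt_mul_gaussianPDFReal hv, abs_of_nonneg (by positivity)]
    refine mul_le_of_le_one_right (by positivity) (Real.exp_le_one_iff.2 ?_)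
    rw [neg_div]
    exact neg_nonpos.2 (by positivity)

lemma tendsto_sqrt_mul_gaussMass (x : ℝ) :
    Tendsto (fun v : ℝ≥0 => √v * gaussMass v x) atTop (𝓝 ((√(2 * Real.pi))⁻¹ * (2 * x))) := by
  have h : Tendsto (fun v : ℝ≥0 => ∫ z in (-x)..x, √v * gaussianPDFReal 0 v z) atTop
      (𝓝 (∫ _ in (-x)..x, (√(2 * Real.pi))⁻¹)) := by
    refine intervalIntegral.tendsto_integral_filter_of_dominated_convergence
      (fun _ => (√(2 * Real.pi))⁻¹) (Eventually.of_forall fun v => ?_)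
      (Eventually.of_forall fun v => ae_of_all _ fun z _ => abs_sqrt_mul_gaussianPDFReal_le v z)
      (by simp) (ae_of_all _ fun z _ => ?_)
    · exact ((measurable_gaussianPDFReal 0 v).const_mul _).aestronglyMeasurable
    · have hv : Tendsto (fun v : ℝ≥0 => -z ^ 2 / (2 * (v : ℝ))) atTop (𝓝 0) :=
        tendsto_const_nhds.div_atTop
          ((NNReal.tendsto_coe_atTop.2 tendsto_id).const_mul_atTop (by norm_num))
      have h' := ((Real.continuous_exp.tendsto 0).comp hv).const_mul (√(2 * Real.pi))⁻¹
      rw [Real.exp_zero, mul_one] at h'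
      refine h'.congr' ?_
      filter_upwards [eventually_ne_atTop 0] with v hv0
      rw [sqrt_mul_gaussianPDFReal hv0, Function.comp_apply]
  simp only [intervalIntegral.integral_const_mul, intervalIntegral.integral_const,
    smul_eq_mul] at h
  convert! h using 2
  ring

lemma abs_sqrt_mul_gaussMass_sub_le (v : ℝ≥0) (x y : ℝ) :
    |√v * gaussMass v x - √v * gaussMass v y| ≤ (√(2 * Real.pi))⁻¹ * (2 * |x - y|) := by
  have hint : ∀ c d, IntervalIntegrable (fun z => √v * gaussianPDFReal 0 v z) volume c d :=
    fun c d => ((integrable_gaussianPDFReal 0 v).const_mul _).intervalIntegrable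
  have hbd : ∀ c d, ‖∫ z in c..d, √v * gaussianPDFReal 0 v z‖ ≤
      (√(2 * Real.pi))⁻¹ * |d - c| := fun c d =>
    intervalIntegral.norm_integral_le_of_norm_le_const fun z _ =>
      abs_sqrt_mul_gaussianPDFReal_le v z
  have h1 := hbd y x
  have h2 := hbd (-x) (-y)
  have hsplit : √v * gaussMass v x - √v * gaussMass v y =
      (∫ z in (-x)..(-y), √v * gaussianPDFReal 0 v z)
        + ∫ z in y..x, √v * gaussianPDFReal 0 v z := by
    rw [gaussMass, gaussMass, ← intervalIntegral.integral_const_mul,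
      ← intervalIntegral.integral_const_mul,
      ← intervalIntegral.integral_add_adjacent_intervals (hint (-x) (-y)) (hint (-y) x),
      ← intervalIntegral.integral_add_adjacent_intervals (hint (-y) y) (hint y x)]
    ring
  rw [neg_sub_neg, Real.norm_eq_abs] at h2
  rw [Real.norm_eq_abs] at h1
  rw [hsplit]
  refine (abs_add_le _ _).trans ?_
  linarith

/-- In phase `n`, the position `x` triggers the passage to phase `n + 1`. -/
def Crossed (a b : ℝ) (n : ℕ) (x : ℝ) : Prop := (Even n ∧ b < x) ∨ (¬ Even n ∧ x < a)

/-- The position `x` lies on the boundary whose crossing ends phase `n`. -/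
def OnEdge (a b : ℝ) (n : ℕ) (x : ℝ) : Prop := (Even n ∧ x = b) ∨ (¬ Even n ∧ x = a)

section Path

variable {Ω : Type*} {a b : ℝ} {X : ℝ≥0 → Ω → ℝ} {ω : Ω}

lemma dcSigma_succ (n : ℕ) : dcSigma a b X ω (n + 1) =
    sInf ((fun u : ℝ≥0 => (u : ℝ≥0∞)) ''
      {u : ℝ≥0 | dcSigma a b X ω n ≤ u ∧ Crossed a b n (X u ω)}) := by
  rw [dcSigma]
  congr! 4 with u
  by_cases h : Even n <;> simp [Crossed, h]

lemma dcSigma_succ_le {n : ℕ} {u : ℝ≥0} (h : dcSigma a b X ω n ≤ u)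
    (hc : Crossed a b n (X u ω)) : dcSigma a b X ω (n + 1) ≤ u := by
  rw [dcSigma_succ]
  exact sInf_le ⟨u, ⟨h, hc⟩, rfl⟩

lemma exists_crossed_of_dcSigma_succ_lt {n : ℕ} {v : ℝ≥0∞} (h : dcSigma a b X ω (n + 1) < v) :
    ∃ u : ℝ≥0, (u : ℝ≥0∞) < v ∧ dcSigma a b X ω n ≤ u ∧ Crossed a b n (X u ω) := by
  rw [dcSigma_succ, sInf_lt_iff] at h
  obtain ⟨_, ⟨u, hu, rfl⟩, huv⟩ := h
  exact ⟨u, huv, hu⟩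

lemma monotone_dcSigma : Monotone (dcSigma a b X ω) := by
  refine monotone_nat_of_le_succ fun n => ?_
  rw [dcSigma_succ]
  refine le_sInf ?_
  rintro _ ⟨u, hu, rfl⟩
  exact hu.1

lemma isOpen_crossed (n : ℕ) : IsOpen {x | Crossed a b n x} := by
  by_cases h : Even n
  · simpa [Crossed, h] using isOpen_lt continuous_const continuous_id
  · simpa [Crossed, h] using isOpen_lt continuous_id continuous_const

lemma not_crossed_succ (hab : a < b) {n : ℕ} {x : ℝ} (h : Crossed a b n x) :
    ¬ Crossed a b (n + 1) x := by
  rcases h with ⟨h, hx⟩ | ⟨h, hx⟩ <;> simp only [Crossed, Nat.even_add_one, h] <;> grind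

lemma edge_of_dcSigma_succ_eq (hX : Continuous fun t => X t ω) {n : ℕ} {s : ℝ≥0}
    (h : dcSigma a b X ω (n + 1) = s) : (Even n ∧ b ≤ X s ω) ∨ (¬ Even n ∧ X s ω ≤ a) := by
  by_contra hcon
  have hnhds : ∀ᶠ u in 𝓝 s, ¬ Crossed a b n (X u ω) := by
    by_cases hn : Even n
    · have : X s ω < b := by grind
      filter_upwards [hX.continuousAt.eventually_lt continuousAt_const this] with u hu
      simp [Crossed, hn, hu.le]
    · have : a < X s ω := by grind
      filter_upwards [continuousAt_const.eventually_lt hX.continuousAt this] with u hu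
      simp [Crossed, hn, hu.le]
  obtain ⟨l, hl, hl'⟩ := exists_Ico_subset_of_mem_nhds hnhds ⟨s + 1, by simp⟩
  obtain ⟨u, hu, hσ, hc⟩ := exists_crossed_of_dcSigma_succ_lt (X := X) (ω := ω) (a := a) (b := b)
    (n := n) (v := (l : ℝ≥0∞)) (by rw [h]; exact_mod_cast hl)
  have hsu : (s : ℝ≥0∞) ≤ u := h ▸ dcSigma_succ_le hσ hc
  exact hl' ⟨by exact_mod_cast hsu, by exact_mod_cast hu⟩ hc

lemma exists_lt_dcSigma (hab : a < b) (hX : Continuous fun t => X t ω) (s : ℝ≥0) :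
    ∃ n, (s : ℝ≥0∞) < dcSigma a b X ω (n + 1) := by
  by_contra! hcon
  have hfin : ∀ n, dcSigma a b X ω (n + 1) ≠ ⊤ := fun n =>
    ne_top_of_le_ne_top ENNReal.coe_ne_top (hcon n)
  set τ : ℕ → ℝ≥0 := fun n => (dcSigma a b X ω (n + 1)).toNNReal
  have hτ : ∀ n, dcSigma a b X ω (n + 1) = τ n := fun n => (ENNReal.coe_toNNReal (hfin n)).symm
  have hmono : Monotone τ := fun m n hmn =>
    ENNReal.toNNReal_mono (hfin n) (monotone_dcSigma (by omega))
  have hbdd : BddAbove (Set.range τ) := by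
    refine ⟨s, ?_⟩
    rintro _ ⟨n, rfl⟩
    exact_mod_cast hτ n ▸ hcon n
  have hlim := (hX.tendsto _).comp (tendsto_atTop_ciSup hmono hbdd)
  have h2 : Tendsto (fun n : ℕ => 2 * n) atTop atTop :=
    tendsto_atTop_mono (fun n => by simp only [id]; omega) tendsto_id
  have h3 : Tendsto (fun n : ℕ => 2 * n + 1) atTop atTop :=
    (tendsto_add_atTop_nat 1).comp h2
  have hb := ge_of_tendsto (hlim.comp h2) (b := b) (Eventually.of_forall fun n => by
    simpa using edge_of_dcSigma_succ_eq hX (hτ (2 * n)))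
  have ha := le_of_tendsto (hlim.comp h3) (b := a) (Eventually.of_forall fun n => by
    simpa using edge_of_dcSigma_succ_eq hX (hτ (2 * n + 1)))
  linarith

/-- The number of phases completed by time `s`. -/
def phaseAt (a b : ℝ) (X : ℝ≥0 → Ω → ℝ) (s : ℝ≥0) (ω : Ω) : ℕ :=
  sInf {n | (s : ℝ≥0∞) < dcSigma a b X ω (n + 1)}

lemma lt_dcSigma_phaseAt_succ (hab : a < b) (hX : Continuous fun t => X t ω) (s : ℝ≥0) :
    (s : ℝ≥0∞) < dcSigma a b X ω (phaseAt a b X s ω + 1) :=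
  Nat.sInf_mem (s := {n | (s : ℝ≥0∞) < dcSigma a b X ω (n + 1)}) (exists_lt_dcSigma hab hX s)

lemma dcSigma_phaseAt_le (s : ℝ≥0) : dcSigma a b X ω (phaseAt a b X s ω) ≤ s := by
  rcases h : phaseAt a b X s ω with _ | n
  · simp [dcSigma]
  · have : n ∉ {n | (s : ℝ≥0∞) < dcSigma a b X ω (n + 1)} :=
      Nat.notMem_of_lt_sInf (by rw [← phaseAt, h]; exact n.lt_succ_self)
    simpa using this

lemma dcSigma_le_iff_le_phaseAt (hab : a < b) (hX : Continuous fun t => X t ω) {s : ℝ≥0} {n : ℕ} :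
    dcSigma a b X ω n ≤ s ↔ n ≤ phaseAt a b X s ω := by
  refine ⟨fun h => ?_, fun h => (monotone_dcSigma h).trans (dcSigma_phaseAt_le s)⟩
  by_contra! hlt
  exact absurd ((lt_dcSigma_phaseAt_succ hab hX s).trans_le (monotone_dcSigma hlt)) h.not_gt

lemma lt_dcSigma_iff_phaseAt_lt (hab : a < b) (hX : Continuous fun t => X t ω) {s : ℝ≥0} {n : ℕ} :
    (s : ℝ≥0∞) < dcSigma a b X ω n ↔ phaseAt a b X s ω < n := by
  rw [← not_le, dcSigma_le_iff_le_phaseAt hab hX, not_le]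

lemma dcD_eq_phaseAt_div_two (hab : a < b) (hX : Continuous fun t => X t ω) (s : ℝ≥0) :
    dcD a b X s ω = phaseAt a b X s ω / 2 := by
  have : {n : ℕ | 1 ≤ n ∧ dcSigma a b X ω (2 * n) ≤ (s : ℝ≥0∞)} =
      Finset.Icc 1 (phaseAt a b X s ω / 2) := by
    ext n
    simp only [dcSigma_le_iff_le_phaseAt hab hX, Set.mem_ofPred_eq, Finset.coe_Icc, Set.mem_Icc]
    omega
  rw [dcD, this, Set.ncard_coe_finset, Nat.card_Icc, Nat.add_sub_cancel]

/-- The distance that the path, being at `x` in phase `q`, must still travel in the directions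
imposed by the successive phases before phase `j` starts. -/
def remDist (a b : ℝ) (j q : ℕ) (x : ℝ) : ℝ :=
  if q < j then (if Even q then b - x else x - a) + ((j : ℝ) - 1 - q) * (b - a) else 0

lemma remDist_succ_of_onEdge {j q : ℕ} {x : ℝ} (h : OnEdge a b q x) :
    remDist a b j (q + 1) x = remDist a b j q x := by
  unfold remDist
  rcases lt_trichotomy (q + 1) j with hj | rfl | hj
  · rcases h with ⟨hq, rfl⟩ | ⟨hq, rfl⟩ <;>
      simp only [hj, show q < j by omega, Nat.even_add_one, hq] <;> push_cast <;> simp <;> ring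
  · rcases h with ⟨hq, rfl⟩ | ⟨hq, rfl⟩ <;> simp [hq]
  · simp [hj.not_gt, show ¬ q < j by omega]

lemma dcM_eq (hab : a < b) (hX : Continuous fun t => X t ω) (G : ℕ → ℝ) (s : ℝ≥0) :
    2 * (b - a) * dcM a b G X s ω =
      (G (phaseAt a b X s ω / 2) - G (phaseAt a b X s ω / 2 + 1)) *
        remDist a b (2 * (phaseAt a b X s ω / 2) + 2) (phaseAt a b X s ω) (X s ω)
      + 2 * (b - a) * G (phaseAt a b X s ω / 2 + 1) := by
  have hba : b - a ≠ 0 := by linarith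
  simp only [dcM, dcSigma_le_iff_le_phaseAt hab hX, lt_dcSigma_iff_phaseAt_lt hab hX]
  set p := phaseAt a b X s ω
  rw [tsum_eq_single (p / 2)]
  · rcases Nat.even_or_odd' p with ⟨k, hk | hk⟩
    · rw [hk]
      simp [remDist]
      field_simp
      ring
    · have h2 : (2 * k + 1) / 2 = k := by omega
      rw [hk, h2]
      simp [remDist]
      field_simp
      ring
  · intro n hn
    rw [if_neg (by omega), if_neg (by omega), add_zero]

end Path

open scoped Classical in
/-- Update of the phase `q` upon observing the position `x`. -/
def phaseStep (a b : ℝ) (q : ℕ) (x : ℝ) : ℕ := if Crossed a b q x then q + 1 else q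

lemma not_crossed_phaseStep {a b : ℝ} (hab : a < b) (q : ℕ) (x : ℝ) :
    ¬ Crossed a b (phaseStep a b q x) x := by
  unfold phaseStep
  split_ifs with h
  exacts [not_crossed_succ hab h, h]

lemma le_phaseStep (a b : ℝ) (q : ℕ) (x : ℝ) : q ≤ phaseStep a b q x := by
  unfold phaseStep
  split_ifs <;> omega

lemma remDist_nonneg {a b : ℝ} (hab : a < b) {q : ℕ} {x : ℝ} (h : ¬ Crossed a b q x) (j : ℕ) :
    0 ≤ remDist a b j q x := by
  unfold remDist
  split_ifs with hj hq
  · have hx : x ≤ b := by simpa [Crossed, hq] using h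
    have : (q : ℝ) + 1 ≤ j := by exact_mod_cast hj
    exact add_nonneg (by linarith) (mul_nonneg (by linarith) (by linarith))
  · have hx : a ≤ x := by simpa [Crossed, hq] using h
    have : (q : ℝ) + 1 ≤ j := by exact_mod_cast hj
    exact add_nonneg (by linarith) (mul_nonneg (by linarith) (by linarith))
  · rfl

section Grid

variable {Ω : Type*}

/-- The phase seen when the path is only observed at the times `r 0, …, r i`. -/
def gridPhase (a b : ℝ) (X : ℝ≥0 → Ω → ℝ) (r : ℕ → ℝ≥0) : ℕ → Ω → ℕ
  | 0, ω => phaseStep a b 0 (X (r 0) ω)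
  | i + 1, ω => phaseStep a b (gridPhase a b X r i ω) (X (r (i + 1)) ω)

/-- A sequence of increasing grids covering `[0, T]`, starting at `0` and with mesh tending
to `0`. -/
structure IsRefiningGrid (r : ℕ → ℕ → ℝ≥0) (T : ℝ≥0) : Prop where
  mono : ∀ N, Monotone (r N)
  zero : ∀ N, r N 0 = 0
  cover : ∀ N, ∃ i, r N i = T
  mesh : ∀ ε : ℝ≥0, 0 < ε → ∀ᶠ N in atTop, ∀ i, r N (i + 1) ≤ r N i + ε

lemma IsRefiningGrid.exists_mem_Ico {r : ℕ → ℕ → ℝ≥0} {T : ℝ≥0} (hr : IsRefiningGrid r T)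
    {u w : ℝ≥0} (huw : u < w) (hw : w ≤ T) : ∀ᶠ N in atTop, ∃ i, u ≤ r N i ∧ r N i < w := by
  filter_upwards [hr.mesh (w - u) (tsub_pos_of_lt huw)] with N hN
  have hex : ∃ i, u ≤ r N i := by
    obtain ⟨i, hi⟩ := hr.cover N
    exact ⟨i, hi ▸ (huw.trans_le hw).le⟩
  classical
  refine ⟨Nat.find hex, Nat.find_spec hex, ?_⟩
  rcases h : Nat.find hex with _ | i
  · rw [hr.zero]
    exact pos_of_gt huw
  · have hi : r N i < u := not_le.1 (Nat.find_min hex (h ▸ i.lt_succ_self))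
    calc r N (i + 1) ≤ r N i + (w - u) := hN i
      _ < u + (w - u) := by gcongr
      _ = w := add_tsub_cancel_of_le huw.le

variable {a b : ℝ} {X : ℝ≥0 → Ω → ℝ} {ω : Ω} {r : ℕ → ℝ≥0}

lemma not_crossed_gridPhase (hab : a < b) (i : ℕ) :
    ¬ Crossed a b (gridPhase a b X r i ω) (X (r i) ω) := by
  cases i <;> exact not_crossed_phaseStep hab _ _

lemma monotone_gridPhase : Monotone fun i => gridPhase a b X r i ω :=
  monotone_nat_of_le_succ fun _ => le_phaseStep _ _ _ _

lemma dcSigma_phaseStep_le {q : ℕ} {u : ℝ≥0} (h : dcSigma a b X ω q ≤ u) :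
    dcSigma a b X ω (phaseStep a b q (X u ω)) ≤ u := by
  unfold phaseStep
  split_ifs with hc
  exacts [dcSigma_succ_le h hc, h]

lemma dcSigma_gridPhase_le (hr : Monotone r) (i : ℕ) :
    dcSigma a b X ω (gridPhase a b X r i ω) ≤ r i := by
  induction i with
  | zero => exact dcSigma_phaseStep_le (by simp [dcSigma])
  | succ i ih =>
    exact dcSigma_phaseStep_le (ih.trans (by exact_mod_cast hr i.le_succ))

/-- If the observed phase is at least `n` and the current position would end phase `n`, then phase
`n` has been seen to end. -/
lemma succ_le_gridPhase_of_crossed (hab : a < b) {n i : ℕ} (hn : n ≤ gridPhase a b X r i ω)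
    (hc : Crossed a b n (X (r i) ω)) : n + 1 ≤ gridPhase a b X r i ω := by
  refine hn.lt_of_ne fun h => ?_
  exact not_crossed_gridPhase hab i (h ▸ hc)

lemma eventually_le_gridPhase {r : ℕ → ℕ → ℝ≥0} {T : ℝ≥0} (hr : IsRefiningGrid r T) (hab : a < b)
    (hX : Continuous fun t => X t ω) (n : ℕ) {v : ℝ≥0} (hv : v ≤ T)
    (h : dcSigma a b X ω n < v) :
    ∀ᶠ N in atTop, ∀ i, v ≤ r N i → n ≤ gridPhase a b X (r N) i ω := by
  induction n generalizing v with
  | zero => simp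
  | succ n ih =>
    obtain ⟨u, huv, hσ, hc⟩ := exists_crossed_of_dcSigma_succ_lt h
    have hnhds : ∀ᶠ w in 𝓝 u, Crossed a b n (X w ω) :=
      hX.continuousAt.eventually_mem ((isOpen_crossed n).mem_nhds hc)
    obtain ⟨l, hl, hl'⟩ := exists_Ico_subset_of_mem_nhds hnhds ⟨u + 1, by simp⟩
    obtain ⟨u', huu', hu'⟩ := exists_between (lt_min hl (show u < v by exact_mod_cast huv))
    have hu'l := hu'.trans_le (min_le_left _ _)
    have hu'v := hu'.trans_le (min_le_right _ _)
    filter_upwards [ih (hu'v.le.trans hv) (hσ.trans_lt (by exact_mod_cast huu')),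
      hr.exists_mem_Ico hu' ((min_le_right _ _).trans hv)] with N hN ⟨i₀, hi₀, hi₀'⟩ i hi
    have hi₀i : i₀ ≤ i := by
      by_contra! hlt
      have := hr.mono N hlt.le
      exact absurd (hi.trans this) (hi₀'.trans_le (min_le_right _ _)).not_ge
    refine (succ_le_gridPhase_of_crossed hab (hN i₀ hi₀) ?_).trans (monotone_gridPhase hi₀i)
    exact hl' ⟨huu'.le.trans hi₀, hi₀'.trans_le (min_le_left _ _)⟩

/-- The phase observed on fine grids at a grid time `s` is eventually the true one, unless the
path is on the boundary whose crossing ends the observed phase. -/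
lemma eventually_gridPhase_eq {r : ℕ → ℕ → ℝ≥0} {T : ℝ≥0} (hr : IsRefiningGrid r T) (hab : a < b)
    (hX : Continuous fun t => X t ω) {s : ℝ≥0} (hs : s ≤ T) {k : ℕ → ℕ} (hk : ∀ N, r N (k N) = s) :
    ∀ᶠ N in atTop, gridPhase a b X (r N) (k N) ω = phaseAt a b X s ω ∨
      (gridPhase a b X (r N) (k N) ω + 1 = phaseAt a b X s ω ∧
        OnEdge a b (gridPhase a b X (r N) (k N) ω) (X s ω)) := by
  have hle : ∀ N, gridPhase a b X (r N) (k N) ω ≤ phaseAt a b X s ω := fun N => by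
    rw [← dcSigma_le_iff_le_phaseAt hab hX, ← hk N]
    exact dcSigma_gridPhase_le (hr.mono N) _
  have hσ := dcSigma_phaseAt_le (a := a) (b := b) (X := X) (ω := ω) s
  rcases hp : phaseAt a b X s ω with _ | n
  · exact Eventually.of_forall fun N => Or.inl (by simpa [hp] using hle N)
  rw [hp] at hle hσ
  rcases hσ.lt_or_eq with hlt | heq
  · filter_upwards [eventually_le_gridPhase hr hab hX _ hs hlt] with N hN
    exact Or.inl ((hle N).antisymm (hN _ (hk N).ge))
  have hn : ∀ᶠ N in atTop, n ≤ gridPhase a b X (r N) (k N) ω := by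
    rcases n with _ | n
    · simp
    have hσn : dcSigma a b X ω (n + 1) ≤ s := (monotone_dcSigma (n + 1).le_succ).trans heq.le
    have hlt : dcSigma a b X ω (n + 1) < s := by
      refine hσn.lt_of_ne fun h => ?_
      have h1 := edge_of_dcSigma_succ_eq hX h
      have h2 := edge_of_dcSigma_succ_eq hX heq
      grind
    filter_upwards [eventually_le_gridPhase hr hab hX _ hs hlt] with N hN
    exact hN _ (hk N).ge
  filter_upwards [hn] with N hN
  rcases (hle N).lt_or_eq with h | h
  · have hq : gridPhase a b X (r N) (k N) ω = n := by omega
    have h1 := edge_of_dcSigma_succ_eq hX heq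
    have h2 := not_crossed_gridPhase (X := X) (r := r N) (ω := ω) hab (k N)
    rw [hq, hk] at h2
    refine Or.inr ⟨by omega, ?_⟩
    rw [hq]
    simp only [Crossed, OnEdge] at h2 ⊢
    grind
  · exact Or.inl h

lemma eventually_remDist_gridPhase_eq {r : ℕ → ℕ → ℝ≥0} {T : ℝ≥0} (hr : IsRefiningGrid r T)
    (hab : a < b) (hX : Continuous fun t => X t ω) {s : ℝ≥0} (hs : s ≤ T) {k : ℕ → ℕ}
    (hk : ∀ N, r N (k N) = s) (j : ℕ) :
    ∀ᶠ N in atTop, remDist a b j (gridPhase a b X (r N) (k N) ω) (X s ω) =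
      remDist a b j (phaseAt a b X s ω) (X s ω) := by
  filter_upwards [eventually_gridPhase_eq hr hab hX hs hk] with N hN
  rcases hN with h | ⟨h, he⟩
  · rw [h]
  · rw [← h, remDist_succ_of_onEdge he]

end Grid

/-- The grid with `N + 1` equal steps in `[0, s]` followed by `N + 1` equal steps
in `[s, s + d]`, and constant afterwards. -/
def twoPieceGrid (s d : ℝ≥0) (N i : ℕ) : ℝ≥0 :=
  s * ((min i (N + 1) : ℕ) / (N + 1 : ℕ)) + d * ((min (i - (N + 1)) (N + 1) : ℕ) / (N + 1 : ℕ))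

lemma twoPieceGrid_fst (s d : ℝ≥0) (N : ℕ) : twoPieceGrid s d N (N + 1) = s := by
  simp only [twoPieceGrid, min_self, tsub_self, Nat.zero_min, Nat.cast_zero, zero_div, mul_zero,
    add_zero]
  rw [div_self (by positivity), mul_one]

lemma twoPieceGrid_snd (s d : ℝ≥0) (N : ℕ) :
    twoPieceGrid s d N (N + 1 + (N + 1)) = s + d := by
  simp only [twoPieceGrid, add_tsub_cancel_right, min_self]
  rw [min_eq_right (by omega), div_self (by positivity), mul_one, mul_one]

lemma isRefiningGrid_twoPieceGrid (s d : ℝ≥0) : IsRefiningGrid (twoPieceGrid s d) (s + d) where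
  mono N i k hik := by
    unfold twoPieceGrid
    gcongr
  zero N := by simp [twoPieceGrid]
  cover N := ⟨_, twoPieceGrid_snd s d N⟩
  mesh ε hε := by
    have h : Tendsto (fun N : ℕ => (s + d) * ((N : ℝ≥0) + 1)⁻¹) atTop (𝓝 0) := by
      have := (tendsto_one_div_add_atTop_nhds_zero_nat (𝕜 := ℝ≥0)).const_mul (s + d)
      simpa using this
    filter_upwards [h.eventually_lt_const hε] with N hN i
    have hstep : ∀ m n : ℕ, m ≤ n + 1 →
        ((m : ℝ≥0) / (N + 1 : ℕ)) ≤ n / (N + 1 : ℕ) + ((N : ℝ≥0) + 1)⁻¹ := fun m n hmn => by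
      rw [div_eq_mul_inv, div_eq_mul_inv, Nat.cast_add_one, ← add_one_mul]
      gcongr
      exact_mod_cast hmn
    refine le_trans ?_ (add_le_add_right hN.le _)
    calc twoPieceGrid s d N (i + 1) ≤
        s * ((min i (N + 1) : ℕ) / (N + 1 : ℕ) + ((N : ℝ≥0) + 1)⁻¹)
          + d * ((min (i - (N + 1)) (N + 1) : ℕ) / (N + 1 : ℕ) + ((N : ℝ≥0) + 1)⁻¹) := by
          unfold twoPieceGrid
          gcongr
          · exact hstep _ _ (by omega)
          · exact hstep _ _ (by omega)
      _ = twoPieceGrid s d N i + (s + d) * ((N : ℝ≥0) + 1)⁻¹ := by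
          unfold twoPieceGrid
          ring

lemma abs_remDist_phaseStep_sub_le {a b : ℝ} (j : ℕ) {q : ℕ} {x : ℝ} (h : ¬ Crossed a b q x)
    (x' : ℝ) : |remDist a b j (phaseStep a b q x') x' - remDist a b j q x'| ≤
      2 * |x' - x| * ((min (phaseStep a b q x') j : ℕ) - (min q j : ℕ)) := by
  by_cases hc : Crossed a b q x'
  swap
  · simp [phaseStep, hc]
  have hstep : phaseStep a b q x' = q + 1 := by simp [phaseStep, hc]
  rw [hstep]
  by_cases hq : q < j
  swap
  · have h1 : min (q + 1) j = j := by omega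
    have h2 : min q j = j := by omega
    rw [h1, h2]
    simp [remDist, hq, show ¬ q + 1 < j by omega]
  have h1 : min (q + 1) j = q + 1 := by omega
  have h2 : min q j = q := by omega
  rw [h1, h2]
  push_cast
  rw [add_sub_cancel_left, mul_one]
  unfold remDist
  rcases (show q + 1 < j ∨ j = q + 1 by omega) with hj | rfl
  · by_cases he : Even q
    · simp only [Crossed, he, true_and, not_true_eq_false, false_and, or_false, not_lt] at h hc
      simp only [hj, hq, he, Nat.even_add_one, if_true, not_true_eq_false, if_false]
      push_cast
      rw [abs_of_pos (show (0 : ℝ) < x' - x by linarith), abs_le]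
      constructor <;> linarith
    · simp only [Crossed, he, false_and, not_false_eq_true, true_and, false_or, not_lt] at h hc
      simp only [hj, hq, he, Nat.even_add_one, if_true, not_false_eq_true, if_false]
      push_cast
      rw [abs_of_neg (show x' - x < 0 by linarith), abs_le]
      constructor <;> linarith
  · by_cases he : Even q
    · simp only [Crossed, he, true_and, not_true_eq_false, false_and, or_false, not_lt] at h hc
      simp only [lt_irrefl, hq, he, if_true, if_false]
      push_cast
      rw [abs_of_pos (show (0 : ℝ) < x' - x by linarith), abs_le]
      constructor <;> linarith
    · simp only [Crossed, he, false_and, not_false_eq_true, true_and, false_or, not_lt] at h hc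
      simp only [lt_irrefl, hq, he, if_true, if_false]
      push_cast
      rw [abs_of_neg (show x' - x < 0 by linarith), abs_le]
      constructor <;> linarith

lemma integral_heatClamp_remDist (a b : ℝ) (n j q : ℕ) (v w : ℝ≥0) (x : ℝ) :
    ∫ z, heatClamp n v (remDist a b j q (x + z)) ∂gaussianReal 0 w =
      heatClamp n (w + v) (remDist a b j q x) := by
  unfold remDist
  split_ifs with hq he
  · rw [← integral_heatClamp_sub]
    congr! 3
    ring
  · rw [← integral_heatClamp_add]
    congr! 3
    ring
  · simp [heatClamp_zero_right]

lemma measurable_phaseStep (a b : ℝ) : Measurable fun p : ℕ × ℝ => phaseStep a b p.1 p.2 := by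
  classical
  refine measurable_from_prod_countable_right fun q => ?_
  simp only [phaseStep]
  exact Measurable.ite (isOpen_crossed q).measurableSet measurable_const measurable_const

lemma measurable_remDist (a b : ℝ) (j : ℕ) : Measurable fun p : ℕ × ℝ => remDist a b j p.1 p.2 := by
  refine measurable_from_prod_countable_right fun q => ?_
  by_cases hq : q < j <;> by_cases he : Even q <;>
    simp only [remDist, hq, he, if_true, if_false] <;> fun_prop

/-- Integrating a function of an `F`-measurable variable and of a variable independent of `F`:
the latter can be integrated out first. -/
lemma setIntegral_comp_of_indep {Ω E : Type*} {F : MeasurableSpace Ω} [m : MeasurableSpace Ω]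
    [MeasurableSpace E] {P : Measure Ω} [IsProbabilityMeasure P] (hF : F ≤ m) {Z : Ω → ℝ}
    (hZ : Measurable Z) (hind : Indep (MeasurableSpace.comap Z Real.measurableSpace) F P)
    {Y : Ω → E} (hY : Measurable[F] Y) {h : E × ℝ → ℝ} (hh : Measurable h) {C : ℝ}
    (hC : ∀ p, |h p| ≤ C) {Γ : Set Ω} (hΓ : MeasurableSet[F] Γ) :
    ∫ ω in Γ, h (Y ω, Z ω) ∂P = ∫ ω in Γ, ∫ z, h (Y ω, z) ∂(P.map Z) ∂P := by
  have : IsProbabilityMeasure (P.map Z) := Measure.isProbabilityMeasure_map hZ.aemeasurable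
  set Y' : Ω → ℝ × E := fun ω => (Γ.indicator (fun _ => 1) ω, Y ω)
  have hY'F : Measurable[F] Y' := by
    refine Measurable.prodMk ?_ hY
    exact Measurable.indicator measurable_const hΓ
  have hY' : Measurable Y' := hY'F.mono hF le_rfl
  have hindep : IndepFun Y' Z P := by
    rw [IndepFun_iff_Indep]
    exact (indep_of_indep_of_le_right hind hY'F.comap_le).symm
  set H : (ℝ × E) × ℝ → ℝ := fun p => p.1.1 * h (p.1.2, p.2)
  have hH : Measurable H := by
    have : Measurable fun p : (ℝ × E) × ℝ => h (p.1.2, p.2) := hh.comp (by fun_prop)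
    exact (measurable_fst.comp measurable_fst).mul this
  have hmul : ∀ (f : Ω → ℝ) (ω : Ω), Γ.indicator f ω = Γ.indicator (fun _ => (1 : ℝ)) ω * f ω :=
    fun f ω => by by_cases hω : ω ∈ Γ <;> simp [hω]
  have hint : Integrable (fun ω => H (Y' ω, Z ω)) P := by
    refine Integrable.of_bound (hH.comp (hY'.prodMk hZ)).aestronglyMeasurable C
      (ae_of_all _ fun ω => ?_)
    have hC0 := (abs_nonneg _).trans (hC (Y ω, Z ω))
    by_cases hω : ω ∈ Γ
    · simpa [H, Y', hω] using hC _
    · simpa [H, Y', hω] using hC0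
  rw [← integral_indicator (hF _ hΓ), ← integral_indicator (hF _ hΓ)]
  calc ∫ ω, Γ.indicator (fun ω => h (Y ω, Z ω)) ω ∂P = ∫ ω, H (Y' ω, Z ω) ∂P :=
        integral_congr_ae (ae_of_all _ fun ω => hmul _ ω)
    _ = ∫ p, H p ∂((P.map Y').prod (P.map Z)) := by
        rw [← hindep.map_prod_eq_prod_map_map hY'.aemeasurable hZ.aemeasurable,
          integral_map (hY'.prodMk hZ).aemeasurable hH.aestronglyMeasurable]
    _ = ∫ y, ∫ z, H (y, z) ∂(P.map Z) ∂(P.map Y') := by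
        refine integral_prod _ ?_
        rw [← hindep.map_prod_eq_prod_map_map hY'.aemeasurable hZ.aemeasurable,
          integrable_map_measure hH.aestronglyMeasurable (hY'.prodMk hZ).aemeasurable]
        exact hint
    _ = ∫ ω, ∫ z, H (Y' ω, z) ∂(P.map Z) ∂P :=
        integral_map hY'.aemeasurable
          hH.stronglyMeasurable.integral_prod_right'.aestronglyMeasurable
    _ = ∫ ω, Γ.indicator (fun ω => ∫ z, h (Y ω, z) ∂(P.map Z)) ω ∂P := by
        refine integral_congr_ae (ae_of_all _ fun ω => ?_)
        simp only [H, Y']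
        rw [integral_const_mul]
        exact (hmul (fun ω => ∫ z, h (Y ω, z) ∂(P.map Z)) ω).symm

section GridError

variable {Ω : Type*} {X : ℝ≥0 → Ω → ℝ} {a b : ℝ}

lemma measurable_gridPhase {F : MeasurableSpace Ω} {r : ℕ → ℝ≥0} {i : ℕ}
    (h : ∀ k ≤ i, Measurable[F] (X (r k))) : Measurable[F] (gridPhase a b X r i) := by
  induction i with
  | zero =>
    exact (measurable_phaseStep a b).comp (Measurable.prodMk measurable_const (h 0 le_rfl))
  | succ i ih =>
    exact (measurable_phaseStep a b).comp
      (Measurable.prodMk (ih fun k hk => h k (by omega)) (h (i + 1) le_rfl))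

/-- The error made at step `i` when updating the phase along a grid. -/
def stepError (a b : ℝ) (X : ℝ≥0 → Ω → ℝ) (r : ℕ → ℝ≥0) (T : ℝ≥0) (n j i : ℕ) (ω : Ω) : ℝ :=
  |heatClamp n (T - r (i + 1)) (remDist a b j (gridPhase a b X r (i + 1) ω) (X (r (i + 1)) ω))
    - heatClamp n (T - r (i + 1)) (remDist a b j (gridPhase a b X r i ω) (X (r (i + 1)) ω))|

lemma stepError_le (hab : a < b) (r : ℕ → ℝ≥0) (T : ℝ≥0) (n j i : ℕ) (ω : Ω) :
    stepError a b X r T n j i ω ≤ n * (2 * |X (r (i + 1)) ω - X (r i) ω|) *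
      ((min (gridPhase a b X r (i + 1) ω) j : ℕ) - (min (gridPhase a b X r i ω) j : ℕ)) := by
  refine (abs_heatClamp_sub_le _ _ _ _).trans ?_
  rw [mul_assoc]
  gcongr
  exact abs_remDist_phaseStep_sub_le j (not_crossed_gridPhase hab i) _

lemma stepError_le_two (hab : a < b) (r : ℕ → ℝ≥0) (T : ℝ≥0) (n j i : ℕ) (ω : Ω) :
    stepError a b X r T n j i ω ≤ 2 *
      ((min (gridPhase a b X r (i + 1) ω) j : ℕ) - (min (gridPhase a b X r i ω) j : ℕ)) := by
  have hle : gridPhase a b X r i ω ≤ gridPhase a b X r (i + 1) ω :=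
    monotone_gridPhase i.le_succ
  rcases (min_le_min_right j hle).eq_or_lt with h | h
  · have h' := stepError_le (X := X) hab r T n j i ω
    rw [h] at h' ⊢
    simpa using h'
  · have h1 : (1 : ℝ) ≤
        (min (gridPhase a b X r (i + 1) ω) j : ℕ) - (min (gridPhase a b X r i ω) j : ℕ) := by
      rw [le_sub_iff_add_le, add_comm]
      exact_mod_cast h
    refine (abs_sub _ _).trans ?_
    linarith [abs_heatClamp_le n (T - r (i + 1))
        (remDist a b j (gridPhase a b X r (i + 1) ω) (X (r (i + 1)) ω)),
      abs_heatClamp_le n (T - r (i + 1))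
        (remDist a b j (gridPhase a b X r i ω) (X (r (i + 1)) ω))]

lemma sum_stepError_le {r : ℕ → ℝ≥0} {T : ℝ≥0} {n j k l : ℕ} {ω : Ω} {c : ℝ} (hc : 0 ≤ c)
    (h : ∀ i < l, stepError a b X r T n j (k + i) ω ≤ c *
      ((min (gridPhase a b X r (k + i + 1) ω) j : ℕ)
        - (min (gridPhase a b X r (k + i) ω) j : ℕ))) :
    ∑ i ∈ Finset.range l, stepError a b X r T n j (k + i) ω ≤ c * j := by
  refine (Finset.sum_le_sum fun i hi => h i (Finset.mem_range.1 hi)).trans ?_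
  rw [← Finset.mul_sum]
  refine mul_le_mul_of_nonneg_left ?_ hc
  have := Finset.sum_range_sub
    (fun i => ((min (gridPhase a b X r (k + i) ω) j : ℕ) : ℝ)) l
  simp only [← add_assoc] at this
  rw [this]
  have h1 : ((min (gridPhase a b X r (k + l) ω) j : ℕ) : ℝ) ≤ j := by
    exact_mod_cast min_le_right _ _
  have h2 : (0 : ℝ) ≤ (min (gridPhase a b X r (k + 0) ω) j : ℕ) := by positivity
  linarith

lemma IsRefiningGrid.eventually_abs_increment_le {r : ℕ → ℕ → ℝ≥0} {T : ℝ≥0}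
    (hr : IsRefiningGrid r T) {ω : Ω} (hX : Continuous fun t => X t ω) {ε : ℝ} (hε : 0 < ε) :
    ∀ᶠ N in atTop, ∀ i, r N (i + 1) ≤ T → |X (r N (i + 1)) ω - X (r N i) ω| ≤ ε := by
  have huc := isCompact_Icc.uniformContinuousOn_of_continuous (s := Set.Icc 0 T) hX.continuousOn
  obtain ⟨δ, hδ, h⟩ := Metric.uniformContinuousOn_iff.1 huc ε hε
  filter_upwards [hr.mesh ⟨δ / 2, (half_pos hδ).le⟩ (half_pos hδ)] with N hN i hi
  have hle : r N i ≤ r N (i + 1) := hr.mono N i.le_succ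
  refine (h _ ⟨zero_le, hi⟩ _ ⟨zero_le, hle.trans hi⟩ ?_).le
  have h1 : (r N (i + 1) : ℝ) ≤ r N i + δ / 2 := by exact_mod_cast hN i
  have h2 : (r N i : ℝ) ≤ r N (i + 1) := by exact_mod_cast hle
  rw [NNReal.dist_eq, abs_of_nonneg (by linarith)]
  linarith

end GridError

section Brownian

variable {Ω : Type*} [m : MeasurableSpace Ω] {P : Measure Ω} {X : ℝ≥0 → Ω → ℝ} {a b : ℝ}

lemma IsBrownianMotion.measurable {x : ℝ} (hX : IsBrownianMotion P X x) (t : ℝ≥0) :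
    Measurable (X t) := (hX.stronglyMeasurable t).measurable

lemma IsBrownianMotion.measurable_natFiltration {x : ℝ} (hX : IsBrownianMotion P X x) {s t : ℝ≥0}
    (hst : s ≤ t) : Measurable[natFiltration X t] (X s) := by
  rw [measurable_iff_comap_le]
  exact le_inf (le_iSup₂_of_le s hst le_rfl) (hX.measurable s).comap_le

/-- One step of the martingale property along a grid, before the phase is updated. -/
lemma IsBrownianMotion.setIntegral_heatClamp_step [IsProbabilityMeasure P] {x : ℝ}
    (hX : IsBrownianMotion P X x) {r : ℕ → ℝ≥0} (hr : Monotone r) (n j i : ℕ) {T : ℝ≥0}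
    (hT : r (i + 1) ≤ T) {Γ : Set Ω} (hΓ : MeasurableSet[natFiltration X (r i)] Γ) :
    ∫ ω in Γ, heatClamp n (T - r (i + 1))
        (remDist a b j (gridPhase a b X r i ω) (X (r (i + 1)) ω)) ∂P =
      ∫ ω in Γ, heatClamp n (T - r i) (remDist a b j (gridPhase a b X r i ω) (X (r i) ω)) ∂P := by
  have hri : r i ≤ r (i + 1) := hr i.le_succ
  have hYm : Measurable[natFiltration X (r i)] fun ω => (gridPhase a b X r i ω, X (r i) ω) :=
    Measurable.prodMk (measurable_gridPhase fun k hk => hX.measurable_natFiltration (hr hk))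
      (hX.measurable_natFiltration le_rfl)
  have hh : Measurable fun p : (ℕ × ℝ) × ℝ =>
      heatClamp n (T - r (i + 1)) (remDist a b j p.1.1 (p.1.2 + p.2)) :=
    (continuous_heatClamp _ _).measurable.comp ((measurable_remDist a b j).comp
      (f := fun p : (ℕ × ℝ) × ℝ => (p.1.1, p.1.2 + p.2)) (by fun_prop))
  have key := setIntegral_comp_of_indep ((natFiltration X).le (r i))
    ((hX.measurable (r (i + 1))).sub (hX.measurable (r i))) (hX.indep_incr _ _ hri) hYm hh
    (C := 1) (fun p => abs_heatClamp_le _ _ _) hΓ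
  simp only [Pi.sub_apply, add_sub_cancel] at key
  rw [key]
  have hmap : P.map (X (r (i + 1)) - X (r i)) = gaussianReal 0 (r (i + 1) - r i) :=
    hX.gauss_incr _ _ hri
  rw [hmap]
  simp_rw [integral_heatClamp_remDist]
  rw [add_comm, tsub_add_tsub_cancel hT hri]

lemma IsBrownianMotion.measurable_remDist_gridPhase {x : ℝ} (hX : IsBrownianMotion P X x)
    (r : ℕ → ℝ≥0) (j i : ℕ) (t : ℝ≥0) :
    Measurable fun ω => remDist a b j (gridPhase a b X r i ω) (X t ω) :=
  (measurable_remDist a b j).comp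
    ((measurable_gridPhase fun _ _ => hX.measurable _).prodMk (hX.measurable t))

lemma IsBrownianMotion.integrable_heatClamp_gridPhase [IsFiniteMeasure P] {x : ℝ}
    (hX : IsBrownianMotion P X x) (r : ℕ → ℝ≥0) (n j i : ℕ) (v t : ℝ≥0) :
    Integrable (fun ω => heatClamp n v (remDist a b j (gridPhase a b X r i ω) (X t ω))) P :=
  Integrable.of_bound ((continuous_heatClamp n v).measurable.comp
    (hX.measurable_remDist_gridPhase r j i t)).aestronglyMeasurable 1
    (ae_of_all _ fun _ => abs_heatClamp_le _ _ _)

lemma IsBrownianMotion.integrable_stepError [IsFiniteMeasure P] {x : ℝ}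
    (hX : IsBrownianMotion P X x) (r : ℕ → ℝ≥0) (T : ℝ≥0) (n j i : ℕ) :
    Integrable (stepError a b X r T n j i) P :=
  ((hX.integrable_heatClamp_gridPhase r n j (i + 1) _ _).sub
    (hX.integrable_heatClamp_gridPhase r n j i _ _)).abs

lemma IsBrownianMotion.abs_setIntegral_heatClamp_sub_le [IsProbabilityMeasure P] {x : ℝ}
    (hX : IsBrownianMotion P X x) {r : ℕ → ℝ≥0} (hr : Monotone r) (n j k l : ℕ) {T : ℝ≥0}
    (hT : r (k + l) ≤ T) {Γ : Set Ω} (hΓ : MeasurableSet[natFiltration X (r k)] Γ) :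
    |∫ ω in Γ, heatClamp n (T - r (k + l))
        (remDist a b j (gridPhase a b X r (k + l) ω) (X (r (k + l)) ω)) ∂P
      - ∫ ω in Γ, heatClamp n (T - r k) (remDist a b j (gridPhase a b X r k ω) (X (r k) ω)) ∂P| ≤
      ∫ ω, ∑ i ∈ Finset.range l, stepError a b X r T n j (k + i) ω ∂P := by
  rw [integral_finsetSum _ fun i _ => hX.integrable_stepError r T n j (k + i)]
  induction l with
  | zero => simp
  | succ l ih =>
    rw [Finset.sum_range_succ]
    have hΓ' : MeasurableSet[natFiltration X (r (k + l))] Γ :=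
      (natFiltration X).mono (hr (by omega)) _ hΓ
    have hstep := hX.setIntegral_heatClamp_step (a := a) (b := b) hr n j (k + l) hT hΓ'
    refine (abs_sub_le _ (∫ ω in Γ, heatClamp n (T - r (k + l))
        (remDist a b j (gridPhase a b X r (k + l) ω) (X (r (k + l)) ω)) ∂P) _).trans ?_
    rw [add_comm]
    refine add_le_add (ih ((hr (by omega)).trans hT)) ?_
    rw [← hstep, ← add_assoc, ← integral_sub
      (hX.integrable_heatClamp_gridPhase r n j (k + l + 1) _ _).integrableOn
      (hX.integrable_heatClamp_gridPhase r n j (k + l) _ _).integrableOn]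
    refine abs_integral_le_integral_abs.trans ?_
    exact setIntegral_le_integral (hX.integrable_stepError r T n j (k + l))
      (ae_of_all _ fun _ => abs_nonneg _)

lemma IsBrownianMotion.tendsto_integral_sum_stepError [IsProbabilityMeasure P] {x : ℝ}
    (hX : IsBrownianMotion P X x) (hab : a < b) {r : ℕ → ℕ → ℝ≥0} {T : ℝ≥0}
    (hr : IsRefiningGrid r T) (n j : ℕ) {k l : ℕ → ℕ} (hl : ∀ N, r N (k N + l N) = T) :
    Tendsto (fun N => ∫ ω, ∑ i ∈ Finset.range (l N), stepError a b X (r N) T n j (k N + i) ω ∂P)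
      atTop (𝓝 0) := by
  have hnonneg : ∀ N ω, 0 ≤ ∑ i ∈ Finset.range (l N), stepError a b X (r N) T n j (k N + i) ω :=
    fun N ω => Finset.sum_nonneg fun i _ => abs_nonneg _
  rw [← integral_zero Ω ℝ (μ := P)]
  refine tendsto_integral_filter_of_norm_le_const (Eventually.of_forall fun N => ?_)
    ⟨2 * j, Eventually.of_forall fun N => ae_of_all _ fun ω => ?_⟩ ?_
  · exact (integrable_finsetSum _ fun i _ =>
      hX.integrable_stepError (r N) T n j (k N + i)).aestronglyMeasurable
  · rw [Real.norm_of_nonneg (hnonneg N ω)]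
    exact sum_stepError_le zero_le_two fun i _ => stepError_le_two hab _ _ _ _ _ _
  · filter_upwards [hX.cont] with ω hω
    refine Metric.tendsto_atTop'.2 fun ε hε => ?_
    have hε' : 0 < ε / (n * 2 * j + 1) := by positivity
    obtain ⟨N₀, hN₀⟩ := eventually_atTop.1 (hr.eventually_abs_increment_le hω hε')
    refine ⟨N₀, fun N hN => ?_⟩
    rw [Real.dist_eq, sub_zero, abs_of_nonneg (hnonneg N ω)]
    have hsum : ∑ i ∈ Finset.range (l N), stepError a b X (r N) T n j (k N + i) ω ≤
        n * (2 * (ε / (n * 2 * j + 1))) * j := by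
      refine sum_stepError_le (by positivity) fun i hi => (stepError_le hab _ _ _ _ _ _).trans ?_
      have hle : gridPhase a b X (r N) (k N + i) ω ≤ gridPhase a b X (r N) (k N + i + 1) ω :=
        monotone_gridPhase (k N + i).le_succ
      have hmin : ((min (gridPhase a b X (r N) (k N + i) ω) j : ℕ) : ℝ) ≤
          (min (gridPhase a b X (r N) (k N + i + 1) ω) j : ℕ) := by
        exact_mod_cast min_le_min_right j hle
      refine mul_le_mul_of_nonneg_right ?_ (sub_nonneg.2 hmin)
      gcongr
      exact hN₀ N hN.le _ (hl N ▸ hr.mono N (by omega))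
    refine hsum.trans_lt ?_
    have : n * (2 * (ε / (n * 2 * j + 1))) * j = ε * ((n * 2 * j) / (n * 2 * j + 1) : ℝ) := by
      ring
    rw [this]
    refine mul_lt_of_lt_one_right hε ?_
    rw [div_lt_one (by positivity)]
    linarith

end Brownian

lemma abs_remDist_sub_le {a b : ℝ} (hab : a < b) (k q : ℕ) (x : ℝ) :
    |remDist a b (2 * k + 2) q x - remDist a b (2 * k) q x| ≤
      2 * (b - a) + |b - x| + |x - a| := by
  have hba : 0 < b - a := sub_pos.2 hab
  have h1 := abs_nonneg (b - x)
  have h2 := abs_nonneg (x - a)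
  have h3 := le_abs_self (b - x)
  have h4 := neg_abs_le (b - x)
  have h5 := le_abs_self (x - a)
  have h6 := neg_abs_le (x - a)
  unfold remDist
  rcases (show q < 2 * k ∨ q = 2 * k ∨ q = 2 * k + 1 ∨ 2 * k + 2 ≤ q by omega)
    with h | rfl | rfl | h
  · rw [if_pos (show q < 2 * k + 2 by omega), if_pos h, abs_le]
    push_cast
    constructor <;> linarith
  · simp only [lt_irrefl, if_false, show 2 * k < 2 * k + 2 by omega, if_true, even_two_mul]
    push_cast
    rw [abs_le]
    constructor <;> linarith
  · have : ¬ Even (2 * k + 1) := by simp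
    simp only [show ¬ 2 * k + 1 < 2 * k by omega, if_false, show 2 * k + 1 < 2 * k + 2 by omega,
      if_true, this]
    push_cast
    rw [abs_le]
    constructor <;> linarith
  · rw [if_neg (by omega), if_neg (by omega), sub_self, abs_zero]
    positivity

lemma remDist_pos {a b : ℝ} (hab : a < b) {q j : ℕ} {x : ℝ} (h : ¬ Crossed a b q x) (hj : q < j)
    (ha : x ≠ a) (hb : x ≠ b) : 0 < remDist a b j q x := by
  have hq : (q : ℝ) + 1 ≤ j := by exact_mod_cast hj
  have hmul : 0 ≤ ((j : ℝ) - 1 - q) * (b - a) := mul_nonneg (by linarith) (by linarith)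
  rw [remDist, if_pos hj]
  split_ifs with he
  · have hx : x ≤ b := by simpa [Crossed, he] using h
    linarith [hx.lt_of_ne hb]
  · have hx : a ≤ x := by simpa [Crossed, he] using h
    linarith [hx.lt_of_ne' ha]

lemma not_crossed_phaseAt {Ω : Type*} {X : ℝ≥0 → Ω → ℝ} {ω : Ω} {a b : ℝ} (hab : a < b)
    (hX : Continuous fun t => X t ω) (s : ℝ≥0) :
    ¬ Crossed a b (phaseAt a b X s ω) (X s ω) := fun h =>
  (lt_dcSigma_phaseAt_succ hab hX s).not_ge (dcSigma_succ_le (dcSigma_phaseAt_le s) h)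

lemma hasSum_sub_succ {G : ℕ → ℝ} (hG : Antitone G) (hG0 : Tendsto G atTop (𝓝 0)) (m : ℕ) :
    HasSum (fun n => G (n + m) - G (n + m + 1)) (G m) := by
  rw [hasSum_iff_tendsto_nat_of_nonneg fun n => sub_nonneg.2 (hG (Nat.le_succ _))]
  have h : ∀ n, ∑ i ∈ Finset.range n, (G (i + m) - G (i + m + 1)) = G m - G (n + m) := fun n => by
    have := Finset.sum_range_sub' (fun i => G (i + m)) n
    simpa only [add_right_comm _ 1 m, zero_add] using this
  simp_rw [h]
  simpa using tendsto_const_nhds.sub ((tendsto_add_atTop_iff_nat m).2 hG0)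

lemma hasSum_mul_remDist_sub {G : ℕ → ℝ} (hG : Antitone G) (hG0 : Tendsto G atTop (𝓝 0))
    (a b : ℝ) (q : ℕ) (x : ℝ) :
    HasSum (fun k => (G k - G (k + 1)) * (remDist a b (2 * k + 2) q x - remDist a b (2 * k) q x))
      ((G (q / 2) - G (q / 2 + 1)) * remDist a b (2 * (q / 2) + 2) q x
        + 2 * (b - a) * G (q / 2 + 1)) := by
  rw [← hasSum_nat_add_iff' (q / 2 + 1), Finset.sum_range_succ, Finset.sum_eq_zero]
  · have h0 : remDist a b (2 * (q / 2)) q x = 0 := by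
      rw [remDist, if_neg (by omega)]
    rw [h0, sub_zero, zero_add, add_sub_cancel_left]
    refine ((hasSum_sub_succ hG hG0 (q / 2 + 1)).mul_left (2 * (b - a))).congr_fun fun k => ?_
    rw [remDist, remDist, if_pos (show q < 2 * (k + (q / 2 + 1)) + 2 by omega),
      if_pos (show q < 2 * (k + (q / 2 + 1)) by omega)]
    push_cast
    ring
  · intro k hk
    have hk' := Finset.mem_range.1 hk
    rw [remDist, remDist, if_neg (by omega), if_neg (by omega), sub_zero, mul_zero]

section Penalization

variable {Ω : Type*} [m : MeasurableSpace Ω] {P : Measure Ω}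
  {X : ℝ≥0 → Ω → ℝ} {a b : ℝ}

lemma IsBrownianMotion.map_eq (hX : IsBrownianMotion P X 0) (t : ℝ≥0) :
    P.map (X t) = gaussianReal 0 t := by
  rw [← tsub_zero t, ← hX.gauss_incr 0 t zero_le, tsub_zero]
  refine Measure.map_congr ?_
  filter_upwards [hX.init] with ω hω
  rw [hω, sub_zero]

lemma IsBrownianMotion.ae_ne (hX : IsBrownianMotion P X 0) {t : ℝ≥0} (ht : t ≠ 0) (c : ℝ) :
    ∀ᵐ ω ∂P, X t ω ≠ c := by
  have := nullSingletonClass_gaussianReal (μ := 0) ht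
  refine ae_of_ae_map (hX.measurable t).aemeasurable (p := fun y => y ≠ c) ?_
  rw [hX.map_eq]
  exact Measure.ae_ne _ c

lemma IsBrownianMotion.integrable (hX : IsBrownianMotion P X 0) (t : ℝ≥0) :
    Integrable (X t) P := by
  have h : Integrable id (P.map (X t)) := by
    rw [hX.map_eq]
    exact (memLp_id_gaussianReal 1).integrable le_rfl
  exact h.comp_measurable (hX.measurable t)

lemma IsBrownianMotion.aemeasurable_remDist (hX : IsBrownianMotion P X 0) (hab : a < b)
    (j : ℕ) (s : ℝ≥0) :
    AEMeasurable (fun ω => remDist a b j (phaseAt a b X s ω) (X s ω)) P := by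
  refine aemeasurable_of_tendsto_metrizable_ae' (fun N => (hX.measurable_remDist_gridPhase
    (a := a) (b := b) (twoPieceGrid s 0 N) j (N + 1) s).aemeasurable) ?_
  filter_upwards [hX.cont] with ω hω
  exact tendsto_nhds_of_eventually_eq (eventually_remDist_gridPhase_eq
    (isRefiningGrid_twoPieceGrid s 0) hab hω (by simp) (twoPieceGrid_fst s 0) j)

lemma IsBrownianMotion.aemeasurable_phaseAt (hX : IsBrownianMotion P X 0) (hab : a < b)
    {s : ℝ≥0} (hs : s ≠ 0) : AEMeasurable (phaseAt a b X s) P := by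
  refine aemeasurable_of_tendsto_metrizable_ae' (f := fun N => gridPhase a b X
    (twoPieceGrid s 0 N) (N + 1))
    (fun N => (measurable_gridPhase fun _ _ => hX.measurable _).aemeasurable) ?_
  filter_upwards [hX.cont, hX.ae_ne hs a, hX.ae_ne hs b] with ω hω ha hb
  refine tendsto_nhds_of_eventually_eq ?_
  filter_upwards [eventually_gridPhase_eq (isRefiningGrid_twoPieceGrid s 0) hab hω (by simp)
    (twoPieceGrid_fst s 0)] with N hN
  rcases hN with h | ⟨-, ⟨-, h⟩ | ⟨-, h⟩⟩
  exacts [h, absurd h hb, absurd h ha]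

variable [IsProbabilityMeasure P]

lemma IsBrownianMotion.tendsto_setIntegral_heatClamp_gridPhase (hX : IsBrownianMotion P X 0)
    (hab : a < b) {r : ℕ → ℕ → ℝ≥0} {T : ℝ≥0} (hr : IsRefiningGrid r T) {s : ℝ≥0} (hs : s ≤ T)
    {k : ℕ → ℕ} (hk : ∀ N, r N (k N) = s) (n j : ℕ) (v : ℝ≥0) (Γ : Set Ω) :
    Tendsto (fun N => ∫ ω in Γ, heatClamp n v
        (remDist a b j (gridPhase a b X (r N) (k N) ω) (X s ω)) ∂P) atTop
      (𝓝 (∫ ω in Γ, heatClamp n v (remDist a b j (phaseAt a b X s ω) (X s ω)) ∂P)) := by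
  refine tendsto_integral_filter_of_norm_le_const (Eventually.of_forall fun N =>
      (hX.integrable_heatClamp_gridPhase (r N) n j (k N) v s).integrableOn.aestronglyMeasurable)
    ⟨1, Eventually.of_forall fun N => ae_of_all _ fun ω => abs_heatClamp_le _ _ _⟩
    (ae_restrict_of_ae ?_)
  filter_upwards [hX.cont] with ω hω
  refine tendsto_nhds_of_eventually_eq ?_
  filter_upwards [eventually_remDist_gridPhase_eq hr hab hω hs hk j] with N hN
  rw [hN]

/-- The martingale property of `heatClamp n (T - t) (remDist a b j (phaseAt a b X t) (X t))`
between the times `s` and `T = s + d`. -/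
lemma IsBrownianMotion.setIntegral_clampMul_remDist (hX : IsBrownianMotion P X 0) (hab : a < b)
    (n j : ℕ) (s d : ℝ≥0) {Γ : Set Ω} (hΓ : MeasurableSet[natFiltration X s] Γ) :
    ∫ ω in Γ, clampMul n (remDist a b j (phaseAt a b X (s + d) ω) (X (s + d) ω)) ∂P =
      ∫ ω in Γ, heatClamp n d (remDist a b j (phaseAt a b X s ω) (X s ω)) ∂P := by
  have hr := isRefiningGrid_twoPieceGrid s d
  have h1 := hX.tendsto_setIntegral_heatClamp_gridPhase hab hr le_rfl (twoPieceGrid_snd s d)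
    n j 0 Γ
  have h2 := hX.tendsto_setIntegral_heatClamp_gridPhase hab hr le_self_add
    (twoPieceGrid_fst s d) n j d Γ
  have h3 := hX.tendsto_integral_sum_stepError hab hr n j (twoPieceGrid_snd s d)
  simp_rw [heatClamp_zero_left] at h1
  rw [← sub_eq_zero]
  refine tendsto_nhds_unique (h1.sub h2) (squeeze_zero_norm (fun N => ?_) h3)
  have h := hX.abs_setIntegral_heatClamp_sub_le (a := a) (b := b) (hr.mono N) n j (N + 1) (N + 1)
    (twoPieceGrid_snd s d N).le (Γ := Γ) (by rwa [twoPieceGrid_fst])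
  simpa only [twoPieceGrid_fst, twoPieceGrid_snd, tsub_self, add_tsub_cancel_left,
    heatClamp_zero_left, Real.norm_eq_abs] using h

lemma IsBrownianMotion.setIntegral_phaseAt_lt (hX : IsBrownianMotion P X 0) (hab : a < b)
    (j : ℕ) (s : ℝ≥0) {d : ℝ≥0} (hd : d ≠ 0) {Γ : Set Ω}
    (hΓ : MeasurableSet[natFiltration X s] Γ) :
    ∫ ω in Γ, (if phaseAt a b X (s + d) ω < j then (1 : ℝ) else 0) ∂P =
      ∫ ω in Γ, gaussMass d (remDist a b j (phaseAt a b X s ω) (X s ω)) ∂P := by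
  have hsd : s + d ≠ 0 := by simp [hd]
  have h1 : Tendsto (fun n => ∫ ω in Γ,
      clampMul n (remDist a b j (phaseAt a b X (s + d) ω) (X (s + d) ω)) ∂P) atTop
      (𝓝 (∫ ω in Γ, (if phaseAt a b X (s + d) ω < j then (1 : ℝ) else 0) ∂P)) := by
    refine tendsto_integral_filter_of_norm_le_const (Eventually.of_forall fun n =>
      ((continuous_clampMul n).measurable.comp_aemeasurable
        (hX.aemeasurable_remDist hab j (s + d))).aestronglyMeasurable.restrict)
      ⟨1, Eventually.of_forall fun n => ae_of_all _ fun ω => abs_clampMul_le _ _⟩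
      (ae_restrict_of_ae ?_)
    filter_upwards [hX.cont, hX.ae_ne hsd a, hX.ae_ne hsd b] with ω hω ha hb
    convert tendsto_clampMul (remDist a b j (phaseAt a b X (s + d) ω) (X (s + d) ω)) using 2
    split_ifs with hj
    · rw [sign_pos, SignType.coe_one]
      exact remDist_pos hab (not_crossed_phaseAt hab hω _) hj ha hb
    · simp [remDist, hj]
  have h2 : Tendsto (fun n => ∫ ω in Γ,
      heatClamp n d (remDist a b j (phaseAt a b X s ω) (X s ω)) ∂P) atTop
      (𝓝 (∫ ω in Γ, gaussMass d (remDist a b j (phaseAt a b X s ω) (X s ω)) ∂P)) :=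
    tendsto_integral_filter_of_norm_le_const (Eventually.of_forall fun n =>
      ((continuous_heatClamp n d).measurable.comp_aemeasurable
        (hX.aemeasurable_remDist hab j s)).aestronglyMeasurable.restrict)
      ⟨1, Eventually.of_forall fun n => ae_of_all _ fun ω => abs_heatClamp_le _ _ _⟩
      (ae_of_all _ fun ω => tendsto_heatClamp hd _)
  simp_rw [hX.setIntegral_clampMul_remDist hab _ j s d hΓ] at h1
  exact tendsto_nhds_unique h1 h2

end Penalization

lemma measurable_gaussMass {v : ℝ≥0} (hv : v ≠ 0) : Measurable (gaussMass v) :=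
  measurable_of_tendsto_metrizable (fun n => (continuous_heatClamp n v).measurable)
    (tendsto_pi_nhds.2 fun x => tendsto_heatClamp hv x)

lemma abs_gaussMass_le {v : ℝ≥0} (hv : v ≠ 0) (x : ℝ) : |gaussMass v x| ≤ 1 :=
  le_of_tendsto (tendsto_heatClamp hv x).abs
    (Eventually.of_forall fun n => abs_heatClamp_le n v x)

section Asymptotics

variable {Ω : Type*} [m : MeasurableSpace Ω] {P : Measure Ω} {X : ℝ≥0 → Ω → ℝ} {a b : ℝ}

lemma IsBrownianMotion.integrable_bound [IsFiniteMeasure P] (hX : IsBrownianMotion P X 0)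
    (a b : ℝ) (s : ℝ≥0) :
    Integrable (fun ω => 2 * (b - a) + |b - X s ω| + |X s ω - a|) P :=
  ((integrable_const _).add ((integrable_const b).sub (hX.integrable s)).abs).add
    ((hX.integrable s).sub (integrable_const a)).abs

lemma IsBrownianMotion.integrable_remDist_sub [IsFiniteMeasure P] (hX : IsBrownianMotion P X 0)
    (hab : a < b) (k : ℕ) (s : ℝ≥0) :
    Integrable (fun ω => remDist a b (2 * k + 2) (phaseAt a b X s ω) (X s ω)
      - remDist a b (2 * k) (phaseAt a b X s ω) (X s ω)) P :=
  (hX.integrable_bound a b s).mono' ((hX.aemeasurable_remDist hab _ s).sub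
    (hX.aemeasurable_remDist hab _ s)).aestronglyMeasurable
    (ae_of_all _ fun _ => abs_remDist_sub_le hab _ _ _)

lemma IsBrownianMotion.ae_hasSum_dcM (hX : IsBrownianMotion P X 0) (hab : a < b) {G : ℕ → ℝ}
    (hG : Antitone G) (hG0 : Tendsto G atTop (𝓝 0)) (s : ℝ≥0) :
    ∀ᵐ ω ∂P, HasSum (fun k => (G k - G (k + 1)) *
      (remDist a b (2 * k + 2) (phaseAt a b X s ω) (X s ω)
        - remDist a b (2 * k) (phaseAt a b X s ω) (X s ω)))
      (2 * (b - a) * dcM a b G X s ω) := by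
  filter_upwards [hX.cont] with ω hω
  rw [dcM_eq hab hω]
  exact hasSum_mul_remDist_sub hG hG0 a b _ _

lemma IsBrownianMotion.hasSum_setIntegral_dcM [IsFiniteMeasure P] (hX : IsBrownianMotion P X 0)
    (hab : a < b) {G : ℕ → ℝ} (hG : Antitone G) (hG0 : Tendsto G atTop (𝓝 0)) (s : ℝ≥0)
    (Γ : Set Ω) :
    HasSum (fun k => (G k - G (k + 1)) * ∫ ω in Γ,
      (remDist a b (2 * k + 2) (phaseAt a b X s ω) (X s ω)
        - remDist a b (2 * k) (phaseAt a b X s ω) (X s ω)) ∂P)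
      (2 * (b - a) * ∫ ω in Γ, dcM a b G X s ω ∂P) := by
  have hsum := (hasSum_sub_succ hG hG0 0).summable
  have hnn : ∀ k, 0 ≤ G k - G (k + 1) := fun k => sub_nonneg.2 (hG k.le_succ)
  have hint := fun k => (hX.integrable_remDist_sub hab k s).restrict (s := Γ)
  have h := hasSum_integral_of_summable_integral_norm
    (fun k => (hint k).const_mul (G k - G (k + 1))) ?_
  · simp_rw [integral_const_mul] at h
    have heq := integral_congr_ae (ae_restrict_of_ae (s := Γ)
      ((hX.ae_hasSum_dcM hab hG hG0 s).mono fun ω hω => hω.tsum_eq))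
    rw [heq, integral_const_mul] at h
    exact h
  · refine Summable.of_nonneg_of_le (fun k => integral_nonneg fun _ => norm_nonneg _) (fun k => ?_)
      (hsum.mul_right (∫ ω in Γ, (2 * (b - a) + |b - X s ω| + |X s ω - a|) ∂P))
    simp_rw [norm_mul, integral_const_mul, Real.norm_of_nonneg (hnn k)]
    refine mul_le_mul_of_nonneg_left (integral_mono (hint k).norm
      (hX.integrable_bound a b s).restrict fun ω => abs_remDist_sub_le hab _ _ _) (hnn k)

lemma IsBrownianMotion.integral_dcM_pos [IsProbabilityMeasure P] (hX : IsBrownianMotion P X 0)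
    (hab : a < b) {G : ℕ → ℝ} (hG : Antitone G) (hG0 : Tendsto G atTop (𝓝 0))
    (hGpos : ∀ n, 0 < G n) (s : ℝ≥0) : 0 < ∫ ω, dcM a b G X s ω ∂P := by
  have hba : 0 < 2 * (b - a) := by linarith
  have hnn : ∀ k, 0 ≤ G k - G (k + 1) := fun k => sub_nonneg.2 (hG k.le_succ)
  have hpos : ∀ᵐ ω ∂P, 0 < 2 * (b - a) * dcM a b G X s ω := by
    filter_upwards [hX.cont] with ω hω
    rw [dcM_eq hab hω]
    exact add_pos_of_nonneg_of_pos (mul_nonneg (hnn _)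
      (remDist_nonneg hab (not_crossed_phaseAt hab hω s) _)) (mul_pos hba (hGpos _))
  have hmeas : AEMeasurable (fun ω => 2 * (b - a) * dcM a b G X s ω) P := by
    refine aemeasurable_of_tendsto_metrizable_ae' (fun N => ?_)
      ((hX.ae_hasSum_dcM hab hG hG0 s).mono fun ω hω => hω.tendsto_sum_nat)
    exact Finset.aemeasurable_fun_sum _ fun k _ =>
      ((hX.integrable_remDist_sub hab k s).aemeasurable.const_mul (G k - G (k + 1)))
  have hint : Integrable (fun ω => 2 * (b - a) * dcM a b G X s ω) P := by
    refine ((hX.integrable_bound a b s).const_mul (G 0)).mono' hmeas.aestronglyMeasurable ?_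
    filter_upwards [hX.ae_hasSum_dcM hab hG hG0 s] with ω hω
    refine hω.norm_le_of_bounded ((hasSum_sub_succ hG hG0 0).mul_right _) fun k => ?_
    rw [norm_mul, Real.norm_of_nonneg (hnn k)]
    exact mul_le_mul_of_nonneg_left (abs_remDist_sub_le hab _ _ _) (hnn k)
  have h : 0 < ∫ ω, 2 * (b - a) * dcM a b G X s ω ∂P := by
    rw [integral_pos_iff_support_of_nonneg_ae (hpos.mono fun _ h => h.le) hint]
    have : Function.support (fun ω => 2 * (b - a) * dcM a b G X s ω) =ᵐ[P] Set.univ := by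
      rw [eventuallyEq_univ]
      exact hpos.mono fun _ h => h.ne'
    rw [measure_congr this]
    simp
  rw [integral_const_mul] at h
  exact pos_of_mul_pos_right h hba.le

variable [IsProbabilityMeasure P]

lemma IsBrownianMotion.integrable_gaussMass (hX : IsBrownianMotion P X 0) (hab : a < b) (j : ℕ)
    (s : ℝ≥0) {d : ℝ≥0} (hd : d ≠ 0) :
    Integrable (fun ω => gaussMass d (remDist a b j (phaseAt a b X s ω) (X s ω))) P :=
  Integrable.of_bound ((measurable_gaussMass hd).comp_aemeasurable
    (hX.aemeasurable_remDist hab j s)).aestronglyMeasurable 1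
    (ae_of_all _ fun _ => abs_gaussMass_le hd _)

lemma IsBrownianMotion.integrable_comp_phaseAt (hX : IsBrownianMotion P X 0) (hab : a < b)
    {s : ℝ≥0} (hs : s ≠ 0) {f : ℕ → ℝ} {C : ℝ} (hf : ∀ q, |f q| ≤ C) :
    Integrable (fun ω => f (phaseAt a b X s ω)) P :=
  Integrable.of_bound ((measurable_from_nat (f := f)).comp_aemeasurable
    (hX.aemeasurable_phaseAt hab hs)).aestronglyMeasurable C (ae_of_all _ fun _ => hf _)

lemma IsBrownianMotion.setIntegral_phaseAt_div_two_eq (hX : IsBrownianMotion P X 0) (hab : a < b)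
    (k : ℕ) (s : ℝ≥0) {d : ℝ≥0} (hd : d ≠ 0) {Γ : Set Ω}
    (hΓ : MeasurableSet[natFiltration X s] Γ) :
    ∫ ω in Γ, (if phaseAt a b X (s + d) ω / 2 = k then (1 : ℝ) else 0) ∂P =
      ∫ ω in Γ, (gaussMass d (remDist a b (2 * k + 2) (phaseAt a b X s ω) (X s ω))
        - gaussMass d (remDist a b (2 * k) (phaseAt a b X s ω) (X s ω))) ∂P := by
  have hsd : s + d ≠ 0 := by simp [hd]
  have hint := fun j : ℕ => (hX.integrable_comp_phaseAt hab hsd (C := 1)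
    (f := fun q => if q < j then (1 : ℝ) else 0) fun q => by split_ifs <;> simp).restrict (s := Γ)
  rw [integral_sub (hX.integrable_gaussMass hab _ s hd).restrict
    (hX.integrable_gaussMass hab _ s hd).restrict, ← hX.setIntegral_phaseAt_lt hab _ s hd hΓ,
    ← hX.setIntegral_phaseAt_lt hab _ s hd hΓ, ← integral_sub (hint _) (hint _)]
  congr! 2 with ω
  split_ifs <;> first | omega | norm_num

lemma IsBrownianMotion.hasSum_setIntegral_dcD (hX : IsBrownianMotion P X 0) (hab : a < b)
    {G : ℕ → ℝ} (hG : Antitone G) (hG0 : Tendsto G atTop (𝓝 0)) (s : ℝ≥0) {d : ℝ≥0} (hd : d ≠ 0)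
    {Γ : Set Ω} (hΓ : MeasurableSet[natFiltration X s] Γ) :
    HasSum (fun k => (G k - G (k + 1)) *
      ∫ ω in Γ, (gaussMass d (remDist a b (2 * k + 2) (phaseAt a b X s ω) (X s ω))
        - gaussMass d (remDist a b (2 * k) (phaseAt a b X s ω) (X s ω))) ∂P)
      (∫ ω in Γ, (G (dcD a b X (s + d) ω) - G (dcD a b X (s + d) ω + 1)) ∂P) := by
  have hsd : s + d ≠ 0 := by simp [hd]
  have hnn : ∀ k, 0 ≤ G k - G (k + 1) := fun k => sub_nonneg.2 (hG k.le_succ)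
  have hbd : ∀ k q : ℕ, |if q / 2 = k then (1 : ℝ) else 0| ≤ 1 := fun k q => by
    split_ifs <;> simp
  have hint := fun k : ℕ =>
    (hX.integrable_comp_phaseAt hab hsd (hbd k)).restrict (s := Γ)
  have h := hasSum_integral_of_summable_integral_norm
    (fun k => (hint k).const_mul (G k - G (k + 1))) ?_
  · simp_rw [integral_const_mul, hX.setIntegral_phaseAt_div_two_eq hab _ s hd hΓ] at h
    have heq : ∫ ω in Γ, (G (dcD a b X (s + d) ω) - G (dcD a b X (s + d) ω + 1)) ∂P =
        ∫ ω in Γ, ∑' k, (G k - G (k + 1)) *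
          (if phaseAt a b X (s + d) ω / 2 = k then (1 : ℝ) else 0) ∂P := by
      refine integral_congr_ae (ae_restrict_of_ae ?_)
      filter_upwards [hX.cont] with ω hω
      rw [dcD_eq_phaseAt_div_two hab hω]
      simp
    rw [heq]
    exact h
  · refine Summable.of_nonneg_of_le (fun k => integral_nonneg fun _ => norm_nonneg _) (fun k => ?_)
      (hasSum_sub_succ hG hG0 0).summable
    simp_rw [norm_mul, integral_const_mul, Real.norm_of_nonneg (hnn k)]
    refine mul_le_of_le_one_right (hnn k) ?_
    refine (integral_mono (hint k).norm (integrable_const 1) fun ω => hbd k _).trans ?_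
    simp

lemma IsBrownianMotion.tendsto_sqrt_mul_setIntegral_dcD (hX : IsBrownianMotion P X 0)
    (hab : a < b) {G : ℕ → ℝ} (hG : Antitone G) (hG0 : Tendsto G atTop (𝓝 0)) (s : ℝ≥0)
    {Γ : Set Ω} (hΓ : MeasurableSet[natFiltration X s] Γ) :
    Tendsto (fun d : ℝ≥0 =>
        √d * ∫ ω in Γ, (G (dcD a b X (s + d) ω) - G (dcD a b X (s + d) ω + 1)) ∂P) atTop
      (𝓝 ((√(2 * Real.pi))⁻¹ * 2 * (2 * (b - a) * ∫ ω in Γ, dcM a b G X s ω ∂P))) := by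
  have hnn : ∀ k, 0 ≤ G k - G (k + 1) := fun k => sub_nonneg.2 (hG k.le_succ)
  have hne : ∀ᶠ d : ℝ≥0 in atTop, d ≠ 0 := eventually_ne_atTop 0
  set u : ℕ → Ω → ℝ := fun j ω => remDist a b j (phaseAt a b X s ω) (X s ω)
  have hsum := fun (d : ℝ≥0) (hd : d ≠ 0) =>
    (hX.hasSum_setIntegral_dcD hab hG hG0 s hd hΓ).mul_left √(d : ℝ)
  rw [← ((hX.hasSum_setIntegral_dcM hab hG hG0 s Γ).mul_left _).tsum_eq]
  have hcongr : (fun d : ℝ≥0 => ∑' k, √(d : ℝ) * ((G k - G (k + 1)) *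
      ∫ ω in Γ, (gaussMass d (u (2 * k + 2) ω) - gaussMass d (u (2 * k) ω)) ∂P)) =ᶠ[atTop]
      fun d : ℝ≥0 =>
        √d * ∫ ω in Γ, (G (dcD a b X (s + d) ω) - G (dcD a b X (s + d) ω + 1)) ∂P :=
    hne.mono fun d hd => (hsum d hd).tsum_eq
  refine Tendsto.congr' hcongr ?_
  set C : ℝ := (√(2 * Real.pi))⁻¹ * 2
  have hC : 0 ≤ C := by positivity
  set B : Ω → ℝ := fun ω => C * (2 * (b - a) + |b - X s ω| + |X s ω - a|)
  have hB : Integrable B P := (hX.integrable_bound a b s).const_mul C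
  have hbound : ∀ (d : ℝ≥0) (k : ℕ) (ω : Ω),
      ‖√(d : ℝ) * (gaussMass d (u (2 * k + 2) ω) - gaussMass d (u (2 * k) ω))‖ ≤ B ω :=
    fun d k ω => by
      rw [mul_sub]
      refine (abs_sqrt_mul_gaussMass_sub_le d _ _).trans ?_
      rw [← mul_assoc]
      exact mul_le_mul_of_nonneg_left (abs_remDist_sub_le hab _ _ _) hC
  refine tendsto_tsum_of_dominated_convergence (bound := fun k => (G k - G (k + 1)) * ∫ ω, B ω ∂P)
    ((hasSum_sub_succ hG hG0 0).summable.mul_right _) (fun k => ?_)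
    (Eventually.of_forall fun d k => ?_)
  · have key : Tendsto (fun d : ℝ≥0 => ∫ ω in Γ, √(d : ℝ) *
        (gaussMass d (u (2 * k + 2) ω) - gaussMass d (u (2 * k) ω)) ∂P) atTop
        (𝓝 (∫ ω in Γ, C * (u (2 * k + 2) ω - u (2 * k) ω) ∂P)) := by
      refine tendsto_integral_filter_of_dominated_convergence B ?_
        (Eventually.of_forall fun d => ae_of_all _ fun ω => hbound d k ω) hB.restrict
        (ae_of_all _ fun ω => ?_)
      · filter_upwards [hne] with d hd
        exact (((hX.integrable_gaussMass hab _ s hd).sub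
          (hX.integrable_gaussMass hab _ s hd)).const_mul _).aestronglyMeasurable.restrict
      · simp_rw [mul_sub]
        simp only [C, mul_assoc]
        exact (tendsto_sqrt_mul_gaussMass _).sub (tendsto_sqrt_mul_gaussMass _)
    simp only [integral_const_mul] at key
    rw [mul_left_comm]
    exact (key.const_mul (G k - G (k + 1))).congr fun d => mul_left_comm _ _ _
  · rw [mul_left_comm, ← integral_const_mul, norm_mul, Real.norm_of_nonneg (hnn k)]
    refine mul_le_mul_of_nonneg_left ?_ (hnn k)
    refine (norm_integral_le_of_norm_le hB.restrict (ae_of_all _ fun ω => hbound d k ω)).trans ?_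
    exact setIntegral_le_integral hB (ae_of_all _ fun ω => (norm_nonneg _).trans (hbound 0 0 ω))

end Asymptotics

lemma tendsto_sqrt_div_sqrt_sub (s : ℝ≥0) :
    Tendsto (fun t : ℝ≥0 => √(t : ℝ) / √((t - s : ℝ≥0) : ℝ)) atTop (𝓝 1) := by
  have hlim : Tendsto (fun t : ℝ≥0 => ((t : ℝ) - s)⁻¹) atTop (𝓝 0) :=
    tendsto_inv_atTop_zero.comp
      (tendsto_atTop_add_const_right _ (-(s : ℝ)) (NNReal.tendsto_coe_atTop.2 tendsto_id))
  have h : Tendsto (fun t : ℝ≥0 => √(1 + s * ((t : ℝ) - s)⁻¹)) atTop (𝓝 1) := by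
    simpa using ((hlim.const_mul (s : ℝ)).const_add 1).sqrt
  refine h.congr' ?_
  filter_upwards [eventually_gt_atTop s] with t ht
  have ht' : (s : ℝ) < t := by exact_mod_cast ht
  rw [NNReal.coe_sub ht.le, ← Real.sqrt_div (NNReal.coe_nonneg t)]
  congr 1
  field_simp [(sub_pos.2 ht').ne']
  ring

/-- Penalization by `ΔG(D_t) = G(D_t) - G(D_t + 1)`: for every `s ≥ 0` and `Γ ∈ F_s`,
`E_0[1_Γ ΔG(D_t)] / E_0[ΔG(D_t)] → E_0[1_Γ M_s^{↓,G}] / M_0^{↓,G}` as `t → ∞`. -/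
theorem penalization_downcrossings
    {Ω : Type*} [m : MeasurableSpace Ω] (P : Measure Ω) [IsProbabilityMeasure P]
    (a b : ℝ) (hab : a < b)
    (X : ℝ≥0 → Ω → ℝ) (hX : IsBrownianMotion P X 0)
    (G : ℕ → ℝ) (hGpos : ∀ n, 0 < G n) (hGanti : Antitone G)
    (hG0 : G 0 = 1) (hGlim : Filter.Tendsto G Filter.atTop (nhds 0)) :
    ∀ (s : ℝ≥0) (Γ : Set Ω), MeasurableSet[natFiltration X s] Γ →
      Tendsto
        (fun t : ℝ≥0 =>
          (∫ ω in Γ, (G (dcD a b X t ω) - G (dcD a b X t ω + 1)) ∂P)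
            / ∫ ω, (G (dcD a b X t ω) - G (dcD a b X t ω + 1)) ∂P)
        atTop
        (nhds ((∫ ω in Γ, dcM a b G X s ω ∂P) / ∫ ω, dcM a b G X 0 ω ∂P)) := by
  intro s Γ hΓ
  set c : ℝ := (√(2 * Real.pi))⁻¹ * 2
  have hc : c ≠ 0 := by positivity
  have hba : 2 * (b - a) ≠ 0 := by linarith
  set D : ℝ := ∫ ω, dcM a b G X 0 ω ∂P
  have hD : D ≠ 0 := (hX.integral_dcM_pos hab hGanti hGlim hGpos 0).ne'
  have hsub : Tendsto (fun t : ℝ≥0 => t - s) atTop atTop := tendsto_atTop.2 fun r =>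
    (eventually_ge_atTop (r + s)).mono fun t ht => le_tsub_of_add_le_right ht
  have hnum := (hX.tendsto_sqrt_mul_setIntegral_dcD hab hGanti hGlim s hΓ).comp hsub
  have hden := hX.tendsto_sqrt_mul_setIntegral_dcD hab hGanti hGlim 0 MeasurableSet.univ
  simp only [zero_add, setIntegral_univ] at hden
  have hlim := (hnum.div hden (by positivity)).mul (tendsto_sqrt_div_sqrt_sub s)
  rw [mul_one, mul_div_mul_left _ _ hc, mul_div_mul_left _ _ hba] at hlim
  refine hlim.congr' ?_
  filter_upwards [eventually_gt_atTop s] with t ht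
  have ht0 : √(t : ℝ) ≠ 0 := (Real.sqrt_pos.2 (NNReal.coe_pos.2 (ht.trans_le' zero_le))).ne'
  have hts : √((t - s : ℝ≥0) : ℝ) ≠ 0 :=
    (Real.sqrt_pos.2 (NNReal.coe_pos.2 (tsub_pos_of_lt ht))).ne'
  simp only [Function.comp, Pi.div_apply, add_tsub_cancel_of_le ht.le]
  field_simp

end
end

section
/- Let (Ω, F, (F_t)_{t≥0}, Q) be a filtered probability space and let (N_t)_{t≥0} be a continuous Q-martingale with N_0 = 1 a.s., N_t > 0 for all t ≥ 0 a.s., and lim_{t→∞} N_t = 0 Q-a.s. Then sup_{t≥0} N_t has the same law as 1/U, where U is uniformly distributed on [0,1]; that is, Q( sup_{t≥0} N_t > A ) = 1/A for every A ≥ 1. -/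
open MeasureTheory ProbabilityTheory Filter
open scoped NNReal ENNReal Topology

/-- The event that the sequence `x` reaches `[A, ∞)` for the first time at index `k`, without
exceeding `B` there. -/
def firstEntry {Ω : Type*} (x : ℕ → Ω → ℝ) (A B : ℝ) (k : ℕ) : Set Ω :=
  {ω | (∀ j < k, x j ω < A) ∧ A ≤ x k ω ∧ x k ω ≤ B}

theorem pairwise_disjoint_firstEntry {Ω : Type*} (x : ℕ → Ω → ℝ) (A B : ℝ) :
    Pairwise (Function.onFun Disjoint (firstEntry x A B)) := by
  intro i j hij
  refine Set.disjoint_left.2 fun ω hi hj => ?_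
  rcases lt_or_gt_of_ne hij with h | h
  · exact (hj.1 i h).not_ge hi.2.1
  · exact (hi.1 j h).not_ge hj.2.1

theorem measurableSet_firstEntry {Ω : Type*} {m : MeasurableSpace Ω} {x : ℕ → Ω → ℝ} (A B : ℝ)
    (k : ℕ) (hx : ∀ j ≤ k, Measurable (x j)) : MeasurableSet (firstEntry x A B k) := by
  have h : firstEntry x A B k =
      (⋂ j ∈ Finset.range k, x j ⁻¹' Set.Iio A) ∩ x k ⁻¹' Set.Icc A B := by
    ext ω
    simp [firstEntry]
  rw [h]
  refine (Finset.measurableSet_biInter _ fun j hj => ?_).inter (hx k le_rfl measurableSet_Icc)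
  exact hx j (Finset.mem_range.1 hj).le measurableSet_Iio

/-- The event that a sequence enters `[A, ∞)` before index `K`, and does so inside `[A, B]`. -/
def entersBetween {Ω : Type*} (x : ℕ → Ω → ℝ) (A B : ℝ) (K : ℕ) : Set Ω :=
  ⋃ k ∈ Finset.range K, firstEntry x A B k

section Martingale

variable {Ω : Type*} {m : MeasurableSpace Ω} {Q : Measure Ω}
  {F : Filtration ℝ≥0 m} {N : ℝ≥0 → Ω → ℝ}

theorem measurableSet_entersBetween (hN : Martingale N F Q) (t : ℕ → ℝ≥0) (A B : ℝ) (K : ℕ) :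
    MeasurableSet (entersBetween (fun k => N (t k)) A B K) :=
  Finset.measurableSet_biUnion _ fun k _ => measurableSet_firstEntry A B k fun j _ =>
    ((hN.stronglyMeasurable (t j)).mono (F.le _)).measurable

/-- On the event of entering `[A, ∞)` inside `[A, B]`, the mean of the terminal value of a
martingale lies in `[A, B]`. -/
theorem setIntegral_entersBetween_mem_Icc [IsFiniteMeasure Q] (hN : Martingale N F Q)
    {t : ℕ → ℝ≥0} (ht : Monotone t) (A B : ℝ) {K : ℕ} {T : ℝ≥0} (hT : ∀ k < K, t k ≤ T) :
    ∫ ω in entersBetween (fun k => N (t k)) A B K, N T ω ∂Q ∈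
      Set.Icc (A * Q.real (entersBetween (fun k => N (t k)) A B K))
        (B * Q.real (entersBetween (fun k => N (t k)) A B K)) := by
  set E := firstEntry (fun k => N (t k)) A B
  have hmF (k : ℕ) : MeasurableSet[F (t k)] (E k) :=
    measurableSet_firstEntry A B k fun j hj =>
      ((hN.stronglyMeasurable (t j)).mono (F.mono (ht hj))).measurable
  have hm (k : ℕ) : MeasurableSet (E k) := F.le _ _ (hmF k)
  have hdisj : Pairwise (Function.onFun Disjoint E) := pairwise_disjoint_firstEntry _ A B
  have hint : ∫ ω in entersBetween (fun k => N (t k)) A B K, N T ω ∂Q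
      = ∑ k ∈ Finset.range K, ∫ ω in E k, N (t k) ω ∂Q := by
    rw [entersBetween, integral_biUnion_finset _ (fun k _ => hm k) (hdisj.set_pairwise _)
      (fun k _ => (hN.integrable T).integrableOn)]
    exact Finset.sum_congr rfl fun k hk =>
      (hN.setIntegral_eq (hT k (Finset.mem_range.1 hk)) (hmF k)).symm
  have hmeas : Q.real (entersBetween (fun k => N (t k)) A B K)
      = ∑ k ∈ Finset.range K, Q.real (E k) :=
    measureReal_biUnion_finset (hdisj.set_pairwise _) fun k _ => hm k
  have hconst (c : ℝ) (k : ℕ) : c * Q.real (E k) = ∫ _ in E k, c ∂Q := by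
    simp [mul_comm]
  rw [hint, hmeas, Finset.mul_sum, Finset.mul_sum]
  refine ⟨Finset.sum_le_sum fun k _ => ?_, Finset.sum_le_sum fun k _ => ?_⟩
  · rw [hconst]
    exact setIntegral_mono_on (integrable_const _).integrableOn (hN.integrable _).integrableOn
      (hm k) fun ω hω => hω.2.1
  · rw [hconst]
    exact setIntegral_mono_on (hN.integrable _).integrableOn (integrable_const _).integrableOn
      (hm k) fun ω hω => hω.2.2

end Martingale

/-- The uniform grid of mesh `T / (n + 1)`. -/
noncomputable def uniformGrid (T : ℝ≥0) (n k : ℕ) : ℝ≥0 := T * k / (n + 1)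

theorem monotone_uniformGrid (T : ℝ≥0) (n : ℕ) : Monotone (uniformGrid T n) := by
  intro i j h
  unfold uniformGrid
  gcongr

theorem uniformGrid_le {T : ℝ≥0} {n k : ℕ} (hk : k < n + 2) : uniformGrid T n k ≤ T := by
  unfold uniformGrid
  refine div_le_of_le_mul₀ (by positivity) (by positivity) ?_
  gcongr
  exact_mod_cast Nat.lt_succ_iff.1 hk

theorem dist_uniformGrid_succ (T : ℝ≥0) (n k : ℕ) :
    dist (uniformGrid T n (k + 1)) (uniformGrid T n k) = T / (n + 1) := by
  rw [NNReal.dist_eq]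
  simp only [uniformGrid, NNReal.coe_div, NNReal.coe_mul, NNReal.coe_add, NNReal.coe_natCast,
    NNReal.coe_one, Nat.cast_add, Nat.cast_one]
  rw [← sub_div, abs_of_nonneg (by ring_nf; positivity)]
  ring

theorem exists_dist_uniformGrid_le {T s : ℝ≥0} (hs : s ≤ T) (n : ℕ) :
    ∃ k < n + 2, dist (uniformGrid T n k) s ≤ T / (n + 1) := by
  have hn : (0 : ℝ) < n + 1 := by positivity
  rcases eq_or_ne T 0 with rfl | hT
  · obtain rfl : s = 0 := le_antisymm hs zero_le
    exact ⟨0, by omega, by simp [uniformGrid]⟩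
  have hT' : (0 : ℝ) < T := by exact_mod_cast pos_iff_ne_zero.2 hT
  have hs' : (s : ℝ) ≤ T := by exact_mod_cast hs
  set y : ℝ := s * (n + 1) / T with hy
  have hy0 : 0 ≤ y := by positivity
  have h1 := Nat.floor_le hy0
  have h2 := Nat.lt_floor_add_one y
  have hsy : (s : ℝ) = T * y / (n + 1) := by rw [hy]; field_simp
  refine ⟨⌊y⌋₊, ?_, ?_⟩
  · have : y ≤ (n + 1 : ℕ) := by
      rw [hy, div_le_iff₀ hT']
      push_cast
      nlinarith
    have : ⌊y⌋₊ ≤ n + 1 := Nat.floor_le_of_le this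
    omega
  · rw [NNReal.dist_eq, hsy]
    simp only [uniformGrid, NNReal.coe_div, NNReal.coe_mul, NNReal.coe_add, NNReal.coe_natCast,
      NNReal.coe_one]
    rw [← sub_div, ← mul_sub, abs_div, abs_mul, abs_of_pos hn, abs_of_pos hT']
    gcongr
    refine mul_le_of_le_one_right hT'.le ?_
    rw [abs_le]
    constructor <;> linarith

/-- A path that starts below `A` and exceeds `A` before time `T` enters `[A, ∞)` inside `[A, B]`
along all sufficiently fine grids. -/
theorem eventually_mem_entersBetween {Ω : Type*} {N : ℝ≥0 → Ω → ℝ} {ω : Ω}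
    (hc : Continuous fun t => N t ω) {A B : ℝ} (h0 : N 0 ω < A) (hAB : A < B) {s T : ℝ≥0}
    (hsT : s ≤ T) (hs : A < N s ω) :
    ∀ᶠ n : ℕ in atTop, ω ∈ entersBetween (fun k => N (uniformGrid T n k)) A B (n + 2) := by
  have huc : UniformContinuousOn (fun t => N t ω) (Set.Icc 0 T) :=
    isCompact_Icc.uniformContinuousOn_of_continuous hc.continuousOn
  obtain ⟨δ, hδ, H⟩ := Metric.uniformContinuousOn_iff.1 huc (min (B - A) (N s ω - A))
    (lt_min (by linarith) (by linarith))
  have hmesh : ∀ᶠ n : ℕ in atTop, (T : ℝ) / (n + 1) < δ :=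
    (tendsto_const_nhds.div_atTop (tendsto_atTop_add_const_right _ 1
      tendsto_natCast_atTop_atTop)).eventually_lt_const hδ
  filter_upwards [hmesh] with n hn
  obtain ⟨k, hk, hks⟩ := exists_dist_uniformGrid_le hsT n
  have hmem {j : ℕ} (hj : j < n + 2) : uniformGrid T n j ∈ Set.Icc 0 T :=
    ⟨zero_le, uniformGrid_le hj⟩
  have hA : A ≤ N (uniformGrid T n k) ω := by
    have := H _ (hmem hk) s ⟨zero_le, hsT⟩ (hks.trans_lt hn)
    rw [Real.dist_eq, abs_lt] at this
    linarith [this.1, min_le_right (B - A) (N s ω - A)]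
  classical
  have hex : ∃ k, A ≤ N (uniformGrid T n k) ω := ⟨k, hA⟩
  have hlt : Nat.find hex < n + 2 := (Nat.find_min' hex hA).trans_lt hk
  have hbefore (j : ℕ) (hj : j < Nat.find hex) : N (uniformGrid T n j) ω < A :=
    not_le.1 (Nat.find_min hex hj)
  refine Set.mem_biUnion (Finset.mem_coe.2 (Finset.mem_range.2 hlt))
    ⟨hbefore, Nat.find_spec hex, ?_⟩
  have hspec := Nat.find_spec hex
  obtain ⟨j, hj⟩ | hz : (∃ j, Nat.find hex = j + 1) ∨ Nat.find hex = 0 := by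
    cases Nat.find hex <;> simp
  · have hb := hbefore j (by omega)
    have := H _ (hmem (hj ▸ hlt)) _ (hmem (show j < n + 2 by omega))
      ((dist_uniformGrid_succ T n j).trans_lt hn)
    rw [Real.dist_eq, abs_lt] at this
    rw [hj]
    linarith [this.2, min_le_left (B - A) (N s ω - A)]
  · rw [hz] at hspec
    simp only [uniformGrid, Nat.cast_zero, mul_zero, zero_div] at hspec
    exact absurd h0 hspec.not_gt

/-- If almost every point of `S` eventually lies in the sets `D n`, a uniform bound on the
measures of the `D n` bounds the measure of `S`. -/
theorem measure_le_of_ae_eventually_mem {Ω : Type*} {m : MeasurableSpace Ω} {μ : Measure Ω}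
    {S : Set Ω} {D : ℕ → Set Ω} {c : ℝ≥0∞} (hS : ∀ᵐ ω ∂μ, ω ∈ S → ∀ᶠ n in atTop, ω ∈ D n)
    (hD : ∀ n, μ (D n) ≤ c) : μ S ≤ c := by
  have hmono : Monotone fun k : ℕ => ⋂ n ≥ k, D n := fun i j hij =>
    Set.biInter_mono (fun n hn => hij.trans hn) fun _ _ => le_rfl
  calc μ S ≤ μ (⋃ k : ℕ, ⋂ n ≥ k, D n) := by
        refine measure_mono_ae ?_
        filter_upwards [hS] with ω hω h
        obtain ⟨k, hk⟩ := eventually_atTop.1 (hω h)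
        exact Set.mem_iUnion.2 ⟨k, Set.mem_iInter₂.2 hk⟩
    _ ≤ c := by
        rw [hmono.measure_iUnion]
        exact iSup_le fun k => (measure_mono (Set.biInter_subset_of_mem le_rfl)).trans (hD k)

section Crossing

variable {Ω : Type*} {m : MeasurableSpace Ω} {Q : Measure Ω} [IsProbabilityMeasure Q]
  {F : Filtration ℝ≥0 m} {N : ℝ≥0 → Ω → ℝ}

theorem integral_eq_one_of_martingale (hN : Martingale N F Q) (hN0 : ∀ᵐ ω ∂Q, N 0 ω = 1)
    (T : ℝ≥0) : ∫ ω, N T ω ∂Q = 1 := by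
  have h := hN.setIntegral_eq (zero_le : 0 ≤ T) MeasurableSet.univ
  rw [setIntegral_univ, setIntegral_univ] at h
  rw [← h, integral_congr_ae hN0]
  simp

theorem measure_exists_lt_le (hMart : Martingale N F Q)
    (hcont : ∀ᵐ ω ∂Q, Continuous fun t : ℝ≥0 => N t ω) (hN0 : ∀ᵐ ω ∂Q, N 0 ω = 1)
    (hpos : ∀ᵐ ω ∂Q, ∀ t : ℝ≥0, 0 < N t ω) {A : ℝ} (hA : 1 < A) :
    Q {ω | ∃ t, A < N t ω} ≤ ENNReal.ofReal (1 / A) := by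
  refine measure_le_of_ae_eventually_mem (D := fun T : ℕ => {ω | ∃ t ≤ (T : ℝ≥0), A < N t ω})
    (ae_of_all _ ?_) fun T => ?_
  · rintro ω ⟨t, ht⟩
    filter_upwards [tendsto_natCast_atTop_atTop.eventually_ge_atTop t] with T hT
    exact ⟨t, hT, ht⟩
  refine measure_le_of_ae_eventually_mem
    (D := fun n => entersBetween (fun k => N (uniformGrid T n k)) A (A + 1) (n + 2)) ?_ fun n => ?_
  · filter_upwards [hcont, hN0] with ω hc h0
    rintro ⟨t, htT, ht⟩
    exact eventually_mem_entersBetween hc (h0 ▸ hA) (by linarith) htT ht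
  · have h := (setIntegral_entersBetween_mem_Icc hMart (monotone_uniformGrid T n) A (A + 1)
      fun k hk => uniformGrid_le hk).1
    have h' := h.trans (setIntegral_le_integral (hMart.integrable T)
      (by filter_upwards [hpos] with ω hω using (hω T).le))
    rw [integral_eq_one_of_martingale hMart hN0] at h'
    rw [← ofReal_measureReal]
    refine ENNReal.ofReal_le_ofReal ?_
    rw [le_div_iff₀ (by linarith)]
    linarith

theorem one_le_mul_measureReal_exists_le (hMart : Martingale N F Q)
    (hcont : ∀ᵐ ω ∂Q, Continuous fun t : ℝ≥0 => N t ω) (hN0 : ∀ᵐ ω ∂Q, N 0 ω = 1)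
    (hpos : ∀ᵐ ω ∂Q, ∀ t : ℝ≥0, 0 < N t ω)
    (hlim : ∀ᵐ ω ∂Q, Tendsto (fun t : ℝ≥0 => N t ω) atTop (𝓝 0))
    {A B : ℝ} (hA : 1 < A) (hAB : A < B) :
    1 ≤ B * Q.real {ω | ∃ t, A ≤ N t ω} := by
  set p := Q.real {ω | ∃ t, A ≤ N t ω}
  have hI (T : ℝ≥0) : Integrable (fun ω => min (N T ω) A) Q :=
    (hMart.integrable T).inf (integrable_const A)
  have hbound (T : ℝ≥0) : 1 ≤ B * p + ∫ ω, min (N T ω) A ∂Q := by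
    let D (n : ℕ) := entersBetween (fun k => N (uniformGrid T n k)) A B (n + 2)
    have hDm (n : ℕ) : MeasurableSet (D n) := measurableSet_entersBetween hMart _ A B _
    let g (ω : Ω) : ℝ := N T ω - min (N T ω) A
    have hg : Integrable g Q := (hMart.integrable T).sub (hI T)
    have hg0 (ω : Ω) : 0 ≤ g ω := sub_nonneg.2 (min_le_left _ _)
    have hstep (n : ℕ) : 1 ≤ B * p + ∫ ω, min (N T ω) A ∂Q + ∫ ω, (D n)ᶜ.indicator g ω ∂Q := by
      have h1 := integral_add_compl (hDm n) (hMart.integrable T)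
      rw [integral_eq_one_of_martingale hMart hN0] at h1
      have h2 := (setIntegral_entersBetween_mem_Icc hMart (monotone_uniformGrid T n) A B
        fun k hk => uniformGrid_le hk).2
      have h3 : Q.real (D n) ≤ p := by
        refine measureReal_mono fun ω hω => ?_
        obtain ⟨k, -, hk⟩ := Set.mem_iUnion₂.1 hω
        exact ⟨_, hk.2.1⟩
      have h4 : ∫ ω in (D n)ᶜ, N T ω ∂Q
          = ∫ ω in (D n)ᶜ, min (N T ω) A ∂Q + ∫ ω, (D n)ᶜ.indicator g ω ∂Q := by
        rw [integral_indicator (hDm n).compl, ← integral_add (hI T).integrableOn hg.integrableOn]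
        simp [g]
      have h5 : ∫ ω in (D n)ᶜ, min (N T ω) A ∂Q ≤ ∫ ω, min (N T ω) A ∂Q :=
        setIntegral_le_integral (hI T)
          (by filter_upwards [hpos] with ω hω using le_min (hω T).le (zero_le_one.trans hA.le))
      have h6 := mul_le_mul_of_nonneg_left h3 (show 0 ≤ B by linarith)
      change ∫ ω in D n, N T ω ∂Q ≤ B * Q.real (D n) at h2
      linarith
    have htend : Tendsto (fun n => ∫ ω, (D n)ᶜ.indicator g ω ∂Q) atTop (𝓝 (∫ _, (0 : ℝ) ∂Q)) := by
      refine tendsto_integral_of_dominated_convergence g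
        (fun n => (hg.indicator (hDm n).compl).aestronglyMeasurable) hg (fun n => ?_) ?_
      · refine ae_of_all _ fun ω => ?_
        rw [Real.norm_of_nonneg (Set.indicator_nonneg (fun ω _ => hg0 ω) ω)]
        exact Set.indicator_le_self' (fun ω _ => hg0 ω) ω
      · filter_upwards [hcont, hN0] with ω hc h0
        refine tendsto_const_nhds.congr' ?_
        rcases le_or_gt (N T ω) A with h | h
        · exact Eventually.of_forall fun n =>
            (Set.indicator_apply_eq_zero.2 fun _ => by simp [g, h]).symm
        · filter_upwards [eventually_mem_entersBetween hc (h0 ▸ hA) hAB le_rfl h] with n hn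
          exact (Set.indicator_of_notMem (Set.notMem_compl_iff.2 hn) _).symm
    have := ge_of_tendsto' (htend.const_add (B * p + ∫ ω, min (N T ω) A ∂Q)) hstep
    simpa using this
  have htend : Tendsto (fun T : ℕ => ∫ ω, min (N T ω) A ∂Q) atTop (𝓝 (∫ _, (0 : ℝ) ∂Q)) := by
    refine tendsto_integral_of_dominated_convergence (fun _ => A)
      (fun T => (hI T).aestronglyMeasurable) (integrable_const A) (fun T => ?_) ?_
    · filter_upwards [hpos] with ω hω
      rw [Real.norm_of_nonneg (le_min (hω T).le (by linarith))]
      exact min_le_right _ _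
    · filter_upwards [hlim] with ω hω
      have := (hω.comp (tendsto_natCast_atTop_atTop (R := ℝ≥0))).min
        (tendsto_const_nhds (x := A))
      rwa [min_eq_left (by linarith)] at this
  have := ge_of_tendsto' (htend.const_add (B * p)) fun T => hbound T
  simpa using this

end Crossing

theorem bddAbove_range_of_tendsto_zero {f : ℝ≥0 → ℝ} (hf : Continuous f)
    (hlim : Tendsto f atTop (𝓝 0)) : BddAbove (Set.range f) := by
  obtain ⟨T, hT⟩ := eventually_atTop.1 (hlim.eventually_le_const zero_lt_one)
  obtain ⟨C, hC⟩ := (isCompact_Icc (a := 0) (b := T)).bddAbove_image hf.continuousOn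
  refine ⟨max C 1, ?_⟩
  rintro _ ⟨t, rfl⟩
  rcases le_total t T with h | h
  · exact (hC ⟨t, ⟨zero_le, h⟩, rfl⟩).trans (le_max_left _ _)
  · exact (hT t h).trans (le_max_right _ _)

/-- If `N` is a positive continuous `Q`-martingale with `N_0 = 1` and `N_t → 0` a.s.,
then `sup_{t ≥ 0} N_t` is distributed as `1/U` with `U` uniform on `[0,1]`:
`Q(sup_t N_t > A) = 1/A` for every `A ≥ 1`. -/
theorem sup_reciprocal_uniform
    {Ω : Type*} [m : MeasurableSpace Ω]
    (Q : Measure Ω) [IsProbabilityMeasure Q]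
    (F : MeasureTheory.Filtration ℝ≥0 m) (N : ℝ≥0 → Ω → ℝ)
    (hMart : Martingale N F Q)
    (hcont : ∀ᵐ ω ∂Q, Continuous fun t : ℝ≥0 => N t ω)
    (hN0 : ∀ᵐ ω ∂Q, N 0 ω = 1)
    (hpos : ∀ᵐ ω ∂Q, ∀ t : ℝ≥0, 0 < N t ω)
    (hlim : ∀ᵐ ω ∂Q, Tendsto (fun t : ℝ≥0 => N t ω) atTop (nhds 0)) :
    ∀ A : ℝ, 1 ≤ A →
      Q {ω | A < sSup (Set.range fun t : ℝ≥0 => N t ω)} = ENNReal.ofReal (1 / A) := by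
  intro A hA
  have hA0 : 0 < A := by linarith
  have hsup : Q {ω | A < sSup (Set.range fun t : ℝ≥0 => N t ω)} = Q {ω | ∃ t, A < N t ω} := by
    refine measure_congr ?_
    filter_upwards [hcont, hlim] with ω hc hl
    refine propext ?_
    change A < sSup (Set.range fun t : ℝ≥0 => N t ω) ↔ ∃ t, A < N t ω
    rw [lt_csSup_iff (bddAbove_range_of_tendsto_zero hc hl) (Set.range_nonempty _)]
    simp
  rw [hsup]
  apply le_antisymm
  · rcases hA.eq_or_lt with rfl | hA1
    · simpa using prob_le_one
    · exact measure_exists_lt_le hMart hcont hN0 hpos hA1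
  · rw [← ofReal_measureReal]
    refine ENNReal.ofReal_le_ofReal ?_
    rw [div_le_iff₀ hA0, mul_comm]
    have hB (B : ℝ) (hB : A < B) : 1 ≤ B * Q.real {ω | ∃ t, A < N t ω} := by
      obtain ⟨A', h1, h2⟩ := exists_between hB
      refine (one_le_mul_measureReal_exists_le hMart hcont hN0 hpos hlim (hA.trans_lt h1) h2).trans
        (mul_le_mul_of_nonneg_left (measureReal_mono ?_) (by linarith))
      rintro ω ⟨t, ht⟩
      exact ⟨t, h1.trans_le ht⟩
    have htend : Tendsto (fun B : ℝ => B * Q.real {ω | ∃ t, A < N t ω}) (𝓝[>] A)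
        (𝓝 (A * Q.real {ω | ∃ t, A < N t ω})) :=
      (tendsto_id.mul_const _).mono_left nhdsWithin_le_nhds
    exact ge_of_tendsto htend (by filter_upwards [self_mem_nhdsWithin] with B h using hB B h)
end
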